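/- Let f(u) := u⁵ log(2+u²). There exists an absolute constant C > 0 such that for every spherically symmetric classical solution u of ∂ₜₜ u = Δu − f(u) on a compact time interval I × ℝ³ with left endpoint t₀, with conserved energy E and with D := ‖∇_{t,x} u(t₀)‖_{H¹(ℝ³)}, one has sup_{t∈I} ‖∇_{t,x} u(t)‖_{H¹(ℝ³)} ≤ C · (2+D)^{(2+D)^{C·E²}}. In particular this bound depends only on E and D and not on the length of the time interval I. -/

import Mathlib

open MeasureTheory Real

noncomputable section

/-- Physical space `ℝ³`. -/
abbrev Sp : Type := EuclideanSpace ℝ (Fin 3)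

/-- The partial derivative of `u : ℝ³ → ℝ` in the `i`-th coordinate direction. -/
noncomputable def pd (i : Fin 3) (u : Sp → ℝ) (x : Sp) : ℝ :=
  fderiv ℝ u x (EuclideanSpace.single i 1)

/-- The spatial Laplacian `Δu = ∑ i, ∂ᵢ∂ᵢ u`. -/
noncomputable def lap (u : Sp → ℝ) (x : Sp) : ℝ := ∑ i, pd i (pd i u) x

/-- The nonlinearity `f(u) = u⁵ log(2 + u²)`. -/
noncomputable def nonlin (u : ℝ) : ℝ := u ^ 5 * Real.log (2 + u ^ 2)

/-- The nonlinear potential `F(u) = ∫₀ᵘ f(v) dv`. -/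
noncomputable def Fpot (u : ℝ) : ℝ := ∫ v in (0:ℝ)..u, nonlin v

/-- A classical solution of `∂ₜₜ u = Δu - f(u)` on `I × ℝ³`: a smooth function which is
compactly supported in space for each time `t ∈ I` and solves the equation pointwise on
`I × ℝ³`. -/
def IsClassicalSolution (I : Set ℝ) (u : ℝ → Sp → ℝ) : Prop :=
  ContDiff ℝ (⊤ : ℕ∞) (fun p : ℝ × Sp => u p.1 p.2) ∧
  (∀ t ∈ I, HasCompactSupport (u t)) ∧
  (∀ t ∈ I, ∀ x, deriv (deriv fun s => u s x) t = lap (u t) x - nonlin (u t x))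

/-- Spherical symmetry: `u(t,x)` depends only on `t` and `|x|`. -/
def IsRadialSolution (I : Set ℝ) (u : ℝ → Sp → ℝ) : Prop :=
  ∀ t ∈ I, ∀ x y : Sp, ‖x‖ = ‖y‖ → u t x = u t y

/-- The energy `E(u)(t) = ∫ ½|∂ₜu|² + ½|∇ₓu|² + F(u) dx`. -/
noncomputable def energy (u : ℝ → Sp → ℝ) (t : ℝ) : ℝ :=
  ∫ x, ((1/2) * (deriv (fun s => u s x) t) ^ 2
      + (1/2) * ∑ i, (pd i (u t) x) ^ 2 + Fpot (u t x))

/-- `D(t) = ‖∇_{t,x} u(t)‖_{H¹(ℝ³)}`, where the `H¹` norm squared of the space-time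
gradient `(∂ₜu, ∂₁u, ∂₂u, ∂₃u)` is the integral of the squares of its components together
with the squares of all their first spatial derivatives. -/
noncomputable def Dquant (u : ℝ → Sp → ℝ) (t : ℝ) : ℝ :=
  Real.sqrt (∫ x, ((deriv (fun s => u s x) t) ^ 2 + ∑ i, (pd i (u t) x) ^ 2
    + ∑ i, (pd i (fun y => deriv (fun s => u s y) t) x) ^ 2
    + ∑ i, ∑ j, (pd i (pd j (u t)) x) ^ 2))

theorem weak_type_maximal {h : ℝ → ENNReal} (S : Set ℝ) (c : ENNReal) (R : ℝ)
    (hS : ∀ x ∈ S, ∃ r > 0, r ≤ R ∧ c * ENNReal.ofReal r ≤ ∫⁻ y in Metric.closedBall x r, h y) :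
    c * volume S ≤ 8 * ∫⁻ y, h y := by
  choose! r hr0 hrR hr using hS
  obtain ⟨u, huS, hdisj, hcov⟩ :=
    Vitali.exists_disjoint_subfamily_covering_enlargement_closedBall S id r R hrR 4 (by norm_num)
  have hcount : u.Countable := by
    refine hdisj.countable_of_nonempty_interior fun a ha => ?_
    refine ⟨a, Metric.ball_subset_interior_closedBall ?_⟩
    simpa using hr0 a (huS ha)
  have hdisj' : u.PairwiseDisjoint fun a => Metric.closedBall a (r a) := hdisj
  have hsub : S ⊆ ⋃ b ∈ u, Metric.closedBall b (4 * r b) := by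
    intro x hx
    obtain ⟨b, hb, hxb⟩ := hcov x hx
    exact Set.mem_biUnion hb (hxb (Metric.mem_closedBall_self (hr0 x hx).le))
  calc c * volume S ≤ c * ∑' b : u, volume (Metric.closedBall (b : ℝ) (4 * r b)) := by
        gcongr
        exact (measure_mono hsub).trans (measure_biUnion_le _ hcount _)
    _ = ∑' b : u, c * ENNReal.ofReal (r b) * 8 := by
        rw [← ENNReal.tsum_mul_left]
        congr 1; ext b
        rw [Real.volume_closedBall, mul_assoc]
        congr 1
        rw [show (8 : ENNReal) = ENNReal.ofReal 8 by simp,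
          ← ENNReal.ofReal_mul (hr0 b (huS b.2)).le]
        congr 1; ring
    _ ≤ ∑' b : u, (∫⁻ y in Metric.closedBall (b : ℝ) (r b), h y) * 8 := by
        refine ENNReal.tsum_le_tsum fun b => ?_
        gcongr
        exact hr b (huS b.2)
    _ = (∫⁻ y in ⋃ b ∈ u, Metric.closedBall b (r b), h y) * 8 := by
        rw [ENNReal.tsum_mul_right, lintegral_biUnion hcount
          (fun _ _ => Metric.isClosed_closedBall.measurableSet) hdisj']
    _ ≤ 8 * ∫⁻ y, h y := by
        rw [mul_comm]
        gcongr
        exact Measure.restrict_le_self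

theorem strong_type_maximal {f h : ℝ → ℝ} (J : Set ℝ) (R : ℝ)
    (hf : Measurable f) (hf0 : ∀ x, 0 ≤ f x) (hh : Measurable h) (hh0 : ∀ x, 0 ≤ h x)
    (H : ∀ x ∈ J, ∃ r > 0, r ≤ R ∧
      ENNReal.ofReal (f x) * ENNReal.ofReal r ≤
        ∫⁻ y in Metric.closedBall x r, ENNReal.ofReal (h y)) :
    ∫⁻ x in J, ENNReal.ofReal (f x ^ 2) ≤ 128 * ∫⁻ y, ENNReal.ofReal (h y ^ 2) := by
  have key : ∀ l > 0, (volume.restrict J) {x | l < f x} * ENNReal.ofReal l ≤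
      16 * ∫⁻ y, Set.indicator {y | l / 4 < h y} (fun y => ENNReal.ofReal (h y)) y := by
    intro l hl
    set k : ℝ → ENNReal := Set.indicator {y | l / 4 < h y} (fun y => ENNReal.ofReal (h y)) with hk
    have hkm : Measurable k :=
      (hh.ennreal_ofReal).indicator (measurableSet_lt measurable_const hh)
    have hle : ∀ y, ENNReal.ofReal (h y) ≤ k y + ENNReal.ofReal (l / 4) := by
      intro y
      by_cases hy : l / 4 < h y
      · simp [hk, hy]
      · simp only [hk, Set.indicator, Set.mem_ofPred_eq, hy, if_false, zero_add]
        exact ENNReal.ofReal_le_ofReal (not_lt.1 hy)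
    have := weak_type_maximal (h := k) ({x | l < f x} ∩ J) (ENNReal.ofReal (l / 2)) R ?_
    · rw [Measure.restrict_apply (measurableSet_lt measurable_const hf)]
      calc _ = 2 * (ENNReal.ofReal (l / 2) * volume ({x | l < f x} ∩ J)) := by
            rw [← mul_assoc, mul_comm, show (2 : ENNReal) = ENNReal.ofReal 2 by simp,
              ← ENNReal.ofReal_mul (by norm_num)]
            congr 2; ring
        _ ≤ 2 * (8 * ∫⁻ y, k y) := by gcongr
        _ = _ := by rw [← mul_assoc]; norm_num
    · rintro x ⟨hxl, hxJ⟩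
      obtain ⟨r, hr0, hrR, hr⟩ := H x hxJ
      refine ⟨r, hr0, hrR, ?_⟩
      have h1 : ENNReal.ofReal l * ENNReal.ofReal r ≤
          (∫⁻ y in Metric.closedBall x r, k y) + ENNReal.ofReal (l / 2 * r) := by
        calc _ ≤ ENNReal.ofReal (f x) * ENNReal.ofReal r := by
              gcongr; exact le_of_lt hxl
          _ ≤ _ := hr
          _ ≤ ∫⁻ y in Metric.closedBall x r, (k y + ENNReal.ofReal (l / 4)) :=
              lintegral_mono fun y => hle y
          _ = _ := by
              rw [lintegral_add_left hkm, setLIntegral_const, Real.volume_closedBall,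
                ← ENNReal.ofReal_mul (by positivity)]
              congr 2; ring
      rw [← ENNReal.ofReal_mul (by positivity)] at h1 ⊢
      rw [show l * r = l / 2 * r + l / 2 * r by ring,
        ENNReal.ofReal_add (by positivity) (by positivity)] at h1
      exact (ENNReal.add_le_add_iff_right ENNReal.ofReal_ne_top).1 h1
  have h2 := lintegral_rpow_eq_lintegral_meas_lt_mul (volume.restrict J)
    (Filter.Eventually.of_forall hf0) hf.aemeasurable (p := 2) (by norm_num)
  norm_num at h2
  rw [h2]
  calc _ ≤ 2 * ∫⁻ l in Set.Ioi (0 : ℝ), 16 *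
        ∫⁻ y, Set.indicator {y | l / 4 < h y} (fun y => ENNReal.ofReal (h y)) y := by
        gcongr 2 * ?_
        exact setLIntegral_mono' measurableSet_Ioi fun l hl => key l hl
    _ = 32 * ∫⁻ l in Set.Ioi (0 : ℝ),
        ∫⁻ y, Set.indicator {y | l / 4 < h y} (fun y => ENNReal.ofReal (h y)) y := by
        rw [lintegral_const_mul' _ _ (by norm_num), ← mul_assoc]; norm_num
    _ = 32 * ∫⁻ y, ∫⁻ l in Set.Ioi (0 : ℝ),
        Set.indicator {y | l / 4 < h y} (fun y => ENNReal.ofReal (h y)) y := by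
        rw [lintegral_lintegral_swap]
        apply Measurable.aemeasurable
        have : MeasurableSet {p : ℝ × ℝ | p.1 / 4 < h p.2} :=
          measurableSet_lt (by fun_prop) (by fun_prop)
        have h3 : Measurable (fun p : ℝ × ℝ => ENNReal.ofReal (h p.2)) := by fun_prop
        exact h3.indicator this
    _ = 32 * ∫⁻ y, 4 * ENNReal.ofReal (h y ^ 2) := by
        congr 1
        refine lintegral_congr fun y => ?_
        have : ∀ l : ℝ, Set.indicator {y | l / 4 < h y} (fun y => ENNReal.ofReal (h y)) y =
            Set.indicator (Set.Iio (4 * h y)) (fun _ => ENNReal.ofReal (h y)) l := by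
          intro l
          have : l / 4 < h y ↔ l < 4 * h y := by constructor <;> intro h <;> linarith
          simp [Set.indicator, this]
        simp_rw [this]
        rw [lintegral_indicator measurableSet_Iio, setLIntegral_const,
          Measure.restrict_apply measurableSet_Iio, Set.inter_comm, Set.Ioi_inter_Iio,
          Real.volume_Ioo, ← ENNReal.ofReal_mul (hh0 y),
          show (4 : ENNReal) = ENNReal.ofReal 4 by simp, ← ENNReal.ofReal_mul (by norm_num)]
        congr 1; ring
    _ = _ := by
        rw [lintegral_const_mul' _ _ (by norm_num), ← mul_assoc]; norm_num

/-! ### Partial derivatives on the half-plane -/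

/-- The derivative in the first (time) variable. -/
def dt (W : ℝ × ℝ → ℝ) (p : ℝ × ℝ) : ℝ := fderiv ℝ W p (1, 0)

/-- The derivative in the second (radial) variable. -/
def dr (W : ℝ × ℝ → ℝ) (p : ℝ × ℝ) : ℝ := fderiv ℝ W p (0, 1)

section calculus

variable {W : ℝ × ℝ → ℝ}

theorem contDiff_dt (h : ContDiff ℝ (⊤ : ℕ∞) W) : ContDiff ℝ (⊤ : ℕ∞) (dt W) :=
  (h.fderiv_right (m := (⊤ : ℕ∞)) (by simp)).clm_apply contDiff_const

theorem contDiff_dr (h : ContDiff ℝ (⊤ : ℕ∞) W) : ContDiff ℝ (⊤ : ℕ∞) (dr W) :=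
  (h.fderiv_right (m := (⊤ : ℕ∞)) (by simp)).clm_apply contDiff_const

theorem hasDerivAt_dt (h : ContDiff ℝ (⊤ : ℕ∞) W) (t r : ℝ) :
    HasDerivAt (fun s => W (s, r)) (dt W (t, r)) t := by
  have h1 := (h.differentiable (by simp) (t, r)).hasFDerivAt
  exact h1.comp_hasDerivAt t ((hasDerivAt_id t).prodMk (hasDerivAt_const t r))

theorem hasDerivAt_dr (h : ContDiff ℝ (⊤ : ℕ∞) W) (t r : ℝ) :
    HasDerivAt (fun s => W (t, s)) (dr W (t, r)) r := by
  have h1 := (h.differentiable (by simp) (t, r)).hasFDerivAt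
  exact h1.comp_hasDerivAt r ((hasDerivAt_const r t).prodMk (hasDerivAt_id r))

theorem hasDerivAt_char (h : ContDiff ℝ (⊤ : ℕ∞) W) (y t : ℝ) :
    HasDerivAt (fun s => W (s, y - s)) (dt W (t, y - t) - dr W (t, y - t)) t := by
  have h1 := (h.differentiable (by simp) (t, y - t)).hasFDerivAt
  have h2 : HasDerivAt (fun s : ℝ => (s, y - s)) ((1, -1) : ℝ × ℝ) t := by
    simpa using (hasDerivAt_id t).prodMk ((hasDerivAt_const t y).sub (hasDerivAt_id t))
  have h3 := h1.comp_hasDerivAt t h2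
  have : ((1, -1) : ℝ × ℝ) = (1, 0) - (0, 1) := by simp
  rw [this, map_sub] at h3
  exact h3

theorem hasDerivAt_char' (h : ContDiff ℝ (⊤ : ℕ∞) W) (y t : ℝ) :
    HasDerivAt (fun s => W (s, y + s)) (dt W (t, y + t) + dr W (t, y + t)) t := by
  have h1 := (h.differentiable (by simp) (t, y + t)).hasFDerivAt
  have h2 : HasDerivAt (fun s : ℝ => (s, y + s)) ((1, 1) : ℝ × ℝ) t := by
    simpa using (hasDerivAt_id t).prodMk ((hasDerivAt_const t y).add (hasDerivAt_id t))
  have h3 := h1.comp_hasDerivAt t h2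
  have : ((1, 1) : ℝ × ℝ) = (1, 0) + (0, 1) := by simp
  rw [this, map_add] at h3
  exact h3

theorem dt_eq_of_hasDerivAt (h : ContDiff ℝ (⊤ : ℕ∞) W) {t r c : ℝ}
    (hc : HasDerivAt (fun s => W (s, r)) c t) : dt W (t, r) = c :=
  (hasDerivAt_dt h t r).unique hc

theorem dr_eq_of_hasDerivAt (h : ContDiff ℝ (⊤ : ℕ∞) W) {t r c : ℝ}
    (hc : HasDerivAt (fun s => W (t, s)) c r) : dr W (t, r) = c :=
  (hasDerivAt_dr h t r).unique hc

theorem dt_dr_comm (h : ContDiff ℝ (⊤ : ℕ∞) W) (p : ℝ × ℝ) : dt (dr W) p = dr (dt W) p := by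
  have hd : DifferentiableAt ℝ (fderiv ℝ W) p :=
    (h.fderiv_right (m := (⊤ : ℕ∞)) (by simp)).differentiable (by simp) p
  have hs : IsSymmSndFDerivAt ℝ W p :=
    h.contDiffAt.isSymmSndFDerivAt (by simpa using WithTop.coe_le_coe.2 (le_top : (2 : ℕ∞) ≤ ⊤))
  have h1 : ∀ v w : ℝ × ℝ, fderiv ℝ (fun q => fderiv ℝ W q v) p w =
      fderiv ℝ (fderiv ℝ W) p w v := by
    intro v w
    rw [fderiv_clm_apply hd (by fun_prop)]
    simp
  unfold dt dr
  rw [h1, h1]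
  exact hs.eq _ _

end calculus

/-- `W` vanishes outside `|r| ≤ R`, at all times in `[t₀, t₁]`. -/
def VanishesOut (t₀ t₁ R : ℝ) (W : ℝ × ℝ → ℝ) : Prop :=
  ∀ t ∈ Set.Icc t₀ t₁, ∀ r, R < |r| → W (t, r) = 0

/-- `W` has parity `σ = ±1` in the radial variable, at all times in `[t₀, t₁]`. -/
def HasParity (t₀ t₁ σ : ℝ) (W : ℝ × ℝ → ℝ) : Prop :=
  ∀ t ∈ Set.Icc t₀ t₁, ∀ r, W (t, -r) = σ * W (t, r)

theorem hasDerivAt_unique_of_eqOn_Icc {t₀ t₁ t a b : ℝ} (hlt : t₀ < t₁) (ht : t ∈ Set.Icc t₀ t₁)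
    {f g : ℝ → ℝ} (hfg : ∀ s ∈ Set.Icc t₀ t₁, f s = g s) (hf : HasDerivAt f a t)
    (hg : HasDerivAt g b t) : a = b := by
  have h1 := hf.hasDerivWithinAt (s := Set.Icc t₀ t₁)
  have h2 : HasDerivWithinAt f b (Set.Icc t₀ t₁) t :=
    hg.hasDerivWithinAt.congr hfg (hfg t ht)
  exact ((uniqueDiffOn_Icc hlt) t ht).eq_deriv _ h1 h2

section support

variable {t₀ t₁ R σ : ℝ} {W : ℝ × ℝ → ℝ}

theorem VanishesOut.timeDeriv (hlt : t₀ < t₁) (h : ContDiff ℝ (⊤ : ℕ∞) W)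
    (hv : VanishesOut t₀ t₁ R W) :
    VanishesOut t₀ t₁ R (dt W) := fun t ht r hr =>
  hasDerivAt_unique_of_eqOn_Icc hlt ht (fun s hs => hv s hs r hr) (hasDerivAt_dt h t r)
    (hasDerivAt_const t 0)

theorem VanishesOut.radialDeriv (h : ContDiff ℝ (⊤ : ℕ∞) W) (hv : VanishesOut t₀ t₁ R W) :
    VanishesOut t₀ t₁ R (dr W) := fun t ht r hr => by
  refine dr_eq_of_hasDerivAt h ((hasDerivAt_const r 0).congr_of_eventuallyEq ?_)
  have : ∀ᶠ s : ℝ in nhds r, R < |s| :=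
    (isOpen_lt continuous_const continuous_abs).mem_nhds hr
  filter_upwards [this] with s hs using hv t ht s hs

theorem VanishesOut.eq_zero (h : Continuous W) (hR : 0 ≤ R) (hv : VanishesOut t₀ t₁ R W) {t r : ℝ}
    (ht : t ∈ Set.Icc t₀ t₁) (hr : R ≤ |r|) : W (t, r) = 0 := by
  have hcl : IsClosed {s : ℝ | W (t, s) = 0} :=
    isClosed_eq (h.comp (by fun_prop)) continuous_const
  have hc : Continuous fun k : ℝ => (1 + k) * r := by fun_prop
  have h1 : Filter.Tendsto (fun k : ℝ => (1 + k) * r) (nhdsWithin 0 (Set.Ioi 0)) (nhds r) := by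
    have := hc.tendsto 0
    simp only [add_zero, one_mul] at this
    exact this.mono_left nhdsWithin_le_nhds
  rcases hR.eq_or_lt with hR0 | hR0
  · by_cases hr0 : r = 0
    · have h2 : Filter.Tendsto (fun k : ℝ => k) (nhdsWithin 0 (Set.Ioi 0)) (nhds r) := by
        rw [hr0]; exact nhdsWithin_le_nhds
      refine hcl.mem_of_tendsto h2 ?_
      filter_upwards [self_mem_nhdsWithin] with k hk
      refine hv t ht k ?_
      rw [← hR0]; exact abs_pos.2 (ne_of_gt hk)
    · exact hv t ht r (by rw [← hR0]; exact abs_pos.2 hr0)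
  · refine hcl.mem_of_tendsto h1 ?_
    filter_upwards [self_mem_nhdsWithin] with k hk
    refine hv t ht _ ?_
    have hk : 0 < k := hk
    rw [abs_mul, abs_of_pos (by linarith)]
    nlinarith

theorem HasParity.timeDeriv (hlt : t₀ < t₁) (h : ContDiff ℝ (⊤ : ℕ∞) W) (hp : HasParity t₀ t₁ σ W) :
    HasParity t₀ t₁ σ (dt W) := fun t ht r =>
  hasDerivAt_unique_of_eqOn_Icc hlt ht (fun s hs => hp s hs r) (hasDerivAt_dt h t (-r))
    ((hasDerivAt_dt h t r).const_mul σ)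

theorem HasParity.radialDeriv (h : ContDiff ℝ (⊤ : ℕ∞) W) (hp : HasParity t₀ t₁ σ W) :
    HasParity t₀ t₁ (-σ) (dr W) := fun t ht r => by
  have h1 : HasDerivAt (fun s => W (t, -s)) (-(dr W (t, -r))) r := by
    simpa [Function.comp_def] using (hasDerivAt_dr h t (-r)).comp r (hasDerivAt_neg r)
  have h2 := (hasDerivAt_dr h t r).const_mul σ
  have h3 : (fun s => W (t, -s)) = fun s => σ * W (t, s) := funext fun s => hp t ht s
  rw [h3] at h1
  have := h1.unique h2
  linarith

end support

theorem intervalIntegral_eq_of_vanish {W : ℝ → ℝ} {R a b : ℝ} (hW : ∀ r, R ≤ |r| → W r = 0)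
    (ha : a ≤ -R) (hb : R ≤ b) : ∫ x in a..b, W x = ∫ x in -R..R, W x := by
  have key : ∀ a b : ℝ, a ≤ -R → R ≤ b → ∫ x in a..b, W x = ∫ x, W x := by
    intro a b ha hb
    refine intervalIntegral.integral_eq_integral_of_support_subset fun x hx => ?_
    have hx' : ¬ R ≤ |x| := fun h => hx (hW x h)
    have := abs_lt.1 (not_le.1 hx')
    exact ⟨by linarith, by linarith⟩
  rw [key a b ha hb, key (-R) R le_rfl le_rfl]

/-! ### The nonlinearity -/

/-- The derivative of `nonlin`. -/
def dnonlin (u : ℝ) : ℝ := 5 * u ^ 4 * Real.log (2 + u ^ 2) + 2 * u ^ 6 / (2 + u ^ 2)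

theorem contDiff_nonlin : ContDiff ℝ (⊤ : ℕ∞) nonlin := by
  unfold nonlin
  refine (contDiff_id.pow 5).mul (ContDiff.log (by fun_prop) fun x => ?_)
  positivity

theorem continuous_nonlin : Continuous nonlin := contDiff_nonlin.continuous

theorem continuous_log_two_add_sq : Continuous fun u : ℝ => Real.log (2 + u ^ 2) :=
  Continuous.log (by fun_prop) fun u => by positivity

theorem continuous_dnonlin : Continuous dnonlin := by
  unfold dnonlin
  refine Continuous.add (by have := continuous_log_two_add_sq; fun_prop) ?_
  exact Continuous.div (by fun_prop) (by fun_prop) fun u => by positivity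

theorem hasDerivAt_log_two_add_sq (u : ℝ) :
    HasDerivAt (fun u : ℝ => Real.log (2 + u ^ 2)) (2 * u / (2 + u ^ 2)) u := by
  have h2 : HasDerivAt (fun u : ℝ => 2 + u ^ 2) (2 * u) u := by
    simpa using ((hasDerivAt_id u).pow 2).const_add 2
  exact h2.log (by positivity)

theorem hasDerivAt_nonlin (u : ℝ) : HasDerivAt nonlin (dnonlin u) u := by
  have h1 : HasDerivAt (fun u : ℝ => u ^ 5) (5 * u ^ 4) u := by
    simpa using hasDerivAt_pow 5 u
  refine (h1.mul (hasDerivAt_log_two_add_sq u)).congr_deriv ?_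
  unfold dnonlin
  ring

theorem log_two_add_sq_ge (u : ℝ) : 0.69 ≤ Real.log (2 + u ^ 2) := by
  have h1 : Real.log 2 ≤ Real.log (2 + u ^ 2) :=
    Real.log_le_log (by norm_num) (by nlinarith [sq_nonneg u])
  have := Real.log_two_gt_d9
  linarith

theorem abs_dnonlin_le (u : ℝ) : |dnonlin u| ≤ 8 * u ^ 4 * Real.log (2 + u ^ 2) := by
  have hL := log_two_add_sq_ge u
  have h0 : 0 ≤ dnonlin u := by unfold dnonlin; positivity
  rw [abs_of_nonneg h0]
  unfold dnonlin
  have h1 : 2 * u ^ 6 / (2 + u ^ 2) ≤ 2 * u ^ 4 := by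
    rw [div_le_iff₀ (by positivity)]
    nlinarith [show 0 ≤ u ^ 4 by positivity]
  nlinarith [show 0 ≤ u ^ 4 by positivity]

theorem hasDerivAt_Fpot (u : ℝ) : HasDerivAt Fpot (nonlin u) u :=
  intervalIntegral.integral_hasDerivAt_right (continuous_nonlin.intervalIntegrable _ _)
    (continuous_nonlin.stronglyMeasurableAtFilter _ _) continuous_nonlin.continuousAt

theorem continuous_Fpot : Continuous Fpot :=
  continuous_iff_continuousAt.2 fun u => (hasDerivAt_Fpot u).continuousAt

theorem Fpot_zero : Fpot 0 = 0 := by simp [Fpot]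

theorem nonneg_of_deriv_sign {G G' : ℝ → ℝ} (h0 : G 0 = 0) (hG : ∀ u, HasDerivAt G (G' u) u)
    (hpos : ∀ u, 0 ≤ u → 0 ≤ G' u) (hneg : ∀ u, u ≤ 0 → G' u ≤ 0) (u : ℝ) : 0 ≤ G u := by
  have hc : Continuous G := continuous_iff_continuousAt.2 fun u => (hG u).continuousAt
  rcases le_total 0 u with h | h
  · have : MonotoneOn G (Set.Ici 0) := by
      refine monotoneOn_of_deriv_nonneg (convex_Ici 0) hc.continuousOn
        (fun x _ => (hG x).differentiableAt.differentiableWithinAt) fun x hx => ?_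
      rw [interior_Ici] at hx
      rw [(hG x).deriv]; exact hpos x (le_of_lt hx)
    rw [← h0]; exact this (Set.mem_Ici.2 le_rfl) h h
  · have : AntitoneOn G (Set.Iic 0) := by
      refine antitoneOn_of_deriv_nonpos (convex_Iic 0) hc.continuousOn
        (fun x _ => (hG x).differentiableAt.differentiableWithinAt) fun x hx => ?_
      rw [interior_Iic] at hx
      rw [(hG x).deriv]; exact hneg x (le_of_lt hx)
    rw [← h0]; exact this h (Set.mem_Iic.2 le_rfl) h

theorem Fpot_nonneg (u : ℝ) : 0 ≤ Fpot u := by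
  refine nonneg_of_deriv_sign Fpot_zero hasDerivAt_Fpot (fun u hu => ?_) (fun u hu => ?_) u
  · have := log_two_add_sq_ge u
    unfold nonlin; positivity
  · have hL := log_two_add_sq_ge u
    unfold nonlin
    have : u ^ 5 ≤ 0 := by
      have : u ^ 5 = u ^ 4 * u := by ring
      rw [this]; exact mul_nonpos_of_nonneg_of_nonpos (by positivity) hu
    exact mul_nonpos_of_nonpos_of_nonneg this (by linarith)

theorem morawetz_density_ge (u : ℝ) :
    2 / 3 * (u ^ 6 * Real.log (2 + u ^ 2)) ≤ u * nonlin u - 2 * Fpot u := by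
  have key : 0 ≤ u ^ 6 * Real.log (2 + u ^ 2) / 6 - Fpot u := by
    refine nonneg_of_deriv_sign (G := fun u => u ^ 6 * Real.log (2 + u ^ 2) / 6 - Fpot u)
      (G' := fun u => u ^ 7 / (3 * (2 + u ^ 2))) (by simp [Fpot_zero]) (fun u => ?_)
      (fun u hu => by positivity) (fun u hu => ?_) u
    · have h1 : HasDerivAt (fun u : ℝ => u ^ 6) (6 * u ^ 5) u := by
        simpa using hasDerivAt_pow 6 u
      refine (((h1.mul (hasDerivAt_log_two_add_sq u)).div_const 6).sub
        (hasDerivAt_Fpot u)).congr_deriv ?_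
      have : (2 + u ^ 2) ≠ 0 := by positivity
      unfold nonlin
      field_simp
      ring
    · have : u ^ 7 ≤ 0 := by
        have : u ^ 7 = u ^ 6 * u := by ring
        rw [this]; exact mul_nonpos_of_nonneg_of_nonpos (by positivity) hu
      exact div_nonpos_of_nonpos_of_nonneg this (by positivity)
  unfold nonlin
  nlinarith

/-! ### One-dimensional inequalities on `[0, R]` -/

section static

variable {R : ℝ} {U U' U'' : ℝ → ℝ}

theorem integral_eq_zero_of_deriv {G g : ℝ → ℝ} {a b : ℝ} (hG : ∀ r, HasDerivAt G (g r) r)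
    (hg : Continuous g) (ha : G a = 0) (hb : G b = 0) : ∫ r in a..b, g r = 0 := by
  rw [intervalIntegral.integral_eq_sub_of_hasDerivAt (fun r _ => hG r)
    (hg.intervalIntegrable _ _), ha, hb, sub_zero]

theorem hasDerivAt_r_mul_sq (hU : ∀ r, HasDerivAt U (U' r) r) (r : ℝ) :
    HasDerivAt (fun r => r * U r ^ 2) (U r ^ 2 + 2 * r * U r * U' r) r := by
  refine ((hasDerivAt_id r).mul ((hU r).pow 2)).congr_deriv ?_
  simp; ring

theorem continuous_of_hasDerivAt (hU : ∀ r, HasDerivAt U (U' r) r) : Continuous U :=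
  continuous_iff_continuousAt.2 fun r => (hU r).continuousAt

theorem integral_sq_deriv_r_mul (hU : ∀ r, HasDerivAt U (U' r) r) (hU' : Continuous U')
    (hR : U R = 0) :
    ∫ r in 0..R, (U r + r * U' r) ^ 2 = ∫ r in 0..R, r ^ 2 * U' r ^ 2 := by
  have hc := continuous_of_hasDerivAt hU
  have h := integral_eq_zero_of_deriv (a := 0) (b := R) (hasDerivAt_r_mul_sq hU)
    (by fun_prop) (by simp) (by simp [hR])
  rw [← sub_eq_zero, ← intervalIntegral.integral_sub
    (Continuous.intervalIntegrable (by fun_prop) _ _)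
    (Continuous.intervalIntegrable (by fun_prop) _ _), ← h]
  congr 1; ext r; ring

theorem r_mul_sq_le (hU : ∀ r, HasDerivAt U (U' r) r) (hU' : Continuous U')
    (hR : U R = 0) {r : ℝ} (h0 : 0 ≤ r) (hr : r ≤ R) :
    r * U r ^ 2 ≤ ∫ s in 0..R, s ^ 2 * U' s ^ 2 := by
  have hc := continuous_of_hasDerivAt hU
  have h := intervalIntegral.integral_eq_sub_of_hasDerivAt (a := r) (b := R)
    (fun r _ => hasDerivAt_r_mul_sq hU r) (Continuous.intervalIntegrable (by fun_prop) _ _)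
  rw [hR] at h
  have h1 : r * U r ^ 2 = ∫ s in r..R, -(U s ^ 2 + 2 * s * U s * U' s) := by
    rw [intervalIntegral.integral_neg, h]; ring
  have h2 : ∫ s in r..R, -(U s ^ 2 + 2 * s * U s * U' s) ≤ ∫ s in r..R, s ^ 2 * U' s ^ 2 := by
    refine intervalIntegral.integral_mono_on hr (Continuous.intervalIntegrable (by fun_prop) _ _)
      (Continuous.intervalIntegrable (by fun_prop) _ _) fun s _ => ?_
    nlinarith [sq_nonneg (U s + s * U' s)]
  have h3 : ∫ s in r..R, s ^ 2 * U' s ^ 2 ≤ ∫ s in 0..R, s ^ 2 * U' s ^ 2 :=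
    intervalIntegral.integral_mono_interval h0 hr le_rfl
      (Filter.Eventually.of_forall fun s => by positivity)
      (Continuous.intervalIntegrable (by fun_prop) _ _)
  linarith

theorem hardy (hR0 : 0 ≤ R) (hU : ∀ r, HasDerivAt U (U' r) r) (hU' : Continuous U')
    (hR : U R = 0) :
    ∫ r in 0..R, U r ^ 2 ≤ 4 * ∫ r in 0..R, r ^ 2 * U' r ^ 2 := by
  have hc := continuous_of_hasDerivAt hU
  have h := integral_eq_zero_of_deriv (a := 0) (b := R) (hasDerivAt_r_mul_sq hU)
    (by fun_prop) (by simp) (by simp [hR])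
  have h1 : ∫ r in 0..R, (U r ^ 2 - 4 * (r ^ 2 * U' r ^ 2)) ≤
      ∫ r in 0..R, 2 * (U r ^ 2 + 2 * r * U r * U' r) := by
    refine intervalIntegral.integral_mono_on hR0 (Continuous.intervalIntegrable (by fun_prop) _ _)
      (Continuous.intervalIntegrable (by fun_prop) _ _) fun s _ => ?_
    nlinarith [sq_nonneg (U s + 2 * s * U' s)]
  rw [intervalIntegral.integral_sub (Continuous.intervalIntegrable (by fun_prop) _ _)
    (Continuous.intervalIntegrable (by fun_prop) _ _), intervalIntegral.integral_const_mul,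
    intervalIntegral.integral_const_mul, h] at h1
  linarith

theorem sq_le_integral (hU : ∀ r, HasDerivAt U (U' r) r) (hU' : Continuous U')
    (hR : U R = 0) {r : ℝ} (h0 : 0 ≤ r) (hr : r ≤ R) :
    U r ^ 2 ≤ (∫ s in 0..R, U s ^ 2) + ∫ s in 0..R, U' s ^ 2 := by
  have hc := continuous_of_hasDerivAt hU
  have hd : ∀ r, HasDerivAt (fun r => U r ^ 2) (2 * U r * U' r) r := fun r =>
    ((hU r).pow 2).congr_deriv (by simp)
  have h := intervalIntegral.integral_eq_sub_of_hasDerivAt (a := r) (b := R)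
    (fun r _ => hd r) (Continuous.intervalIntegrable (by fun_prop) _ _)
  rw [hR] at h
  have h1 : U r ^ 2 = ∫ s in r..R, -(2 * U s * U' s) := by
    rw [intervalIntegral.integral_neg, h]; ring
  have h2 : ∫ s in r..R, -(2 * U s * U' s) ≤ ∫ s in r..R, (U s ^ 2 + U' s ^ 2) := by
    refine intervalIntegral.integral_mono_on hr (Continuous.intervalIntegrable (by fun_prop) _ _)
      (Continuous.intervalIntegrable (by fun_prop) _ _) fun s _ => ?_
    nlinarith [sq_nonneg (U s + U' s)]
  have h3 : ∫ s in r..R, (U s ^ 2 + U' s ^ 2) ≤ ∫ s in 0..R, (U s ^ 2 + U' s ^ 2) :=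
    intervalIntegral.integral_mono_interval h0 hr le_rfl
      (Filter.Eventually.of_forall fun s => by positivity)
      (Continuous.intervalIntegrable (by fun_prop) _ _)
  rw [← intervalIntegral.integral_add (Continuous.intervalIntegrable (by fun_prop) _ _)
    (Continuous.intervalIntegrable (by fun_prop) _ _)]
  linarith

theorem integral_sq_second_deriv_r_mul (hU' : ∀ r, HasDerivAt U' (U'' r) r)
    (hU'' : Continuous U'') (hR : U' R = 0) :
    ∫ r in 0..R, (2 * U' r + r * U'' r) ^ 2 =
      ∫ r in 0..R, (r ^ 2 * U'' r ^ 2 + 2 * U' r ^ 2) := by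
  have hc := continuous_of_hasDerivAt hU'
  have h := integral_eq_zero_of_deriv (a := 0) (b := R) (hasDerivAt_r_mul_sq hU')
    (by fun_prop) (by simp) (by simp [hR])
  have h2 : ∫ r in 0..R, 2 * (U' r ^ 2 + 2 * r * U' r * U'' r) = 0 := by
    rw [intervalIntegral.integral_const_mul, h, mul_zero]
  rw [← sub_eq_zero, ← intervalIntegral.integral_sub
    (Continuous.intervalIntegrable (by fun_prop) _ _)
    (Continuous.intervalIntegrable (by fun_prop) _ _), ← h2]
  congr 1; ext r; ring

theorem sq_mul_deriv_eq_integral (hU' : ∀ r, HasDerivAt U' (U'' r) r) (hU'' : Continuous U'')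
    (r : ℝ) : r ^ 2 * U' r = ∫ s in 0..r, s * (2 * U' s + s * U'' s) := by
  have hc := continuous_of_hasDerivAt hU'
  have hd : ∀ r, HasDerivAt (fun r => r ^ 2 * U' r) (r * (2 * U' r + r * U'' r)) r := fun r => by
    refine (((hasDerivAt_id r).pow 2).mul (hU' r)).congr_deriv ?_
    simp; ring
  rw [intervalIntegral.integral_eq_sub_of_hasDerivAt (fun r _ => hd r)
    (Continuous.intervalIntegrable (by fun_prop) _ _)]
  simp

/-- Cauchy–Schwarz for interval integrals of continuous functions. -/
theorem sq_integral_mul_le {x y : ℝ → ℝ} {a b : ℝ} (hab : a ≤ b) (hx : Continuous x)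
    (hy : Continuous y) :
    (∫ s in a..b, x s * y s) ^ 2 ≤ (∫ s in a..b, x s ^ 2) * ∫ s in a..b, y s ^ 2 := by
  have h : ∀ l : ℝ, 0 ≤ (∫ s in a..b, y s ^ 2) * (l * l) + (-2 * ∫ s in a..b, x s * y s) * l
      + ∫ s in a..b, x s ^ 2 := by
    intro l
    have h1 : 0 ≤ ∫ s in a..b, (x s - l * y s) ^ 2 :=
      intervalIntegral.integral_nonneg hab fun s _ => by positivity
    have h2 : ∫ s in a..b, (x s - l * y s) ^ 2 =
        ∫ s in a..b, (l * l * y s ^ 2 + (-2 * l) * (x s * y s) + x s ^ 2) := by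
      congr 1; ext s; ring
    rw [h2, intervalIntegral.integral_add (Continuous.intervalIntegrable (by fun_prop) _ _)
      (Continuous.intervalIntegrable (by fun_prop) _ _),
      intervalIntegral.integral_add (Continuous.intervalIntegrable (by fun_prop) _ _)
      (Continuous.intervalIntegrable (by fun_prop) _ _), intervalIntegral.integral_const_mul,
      intervalIntegral.integral_const_mul] at h1
    linarith
  have := discrim_le_zero h
  unfold discrim at this
  nlinarith

end static

/-! ### The radial wave equation -/

/-- The reduced unknown `r U(t, r)`. -/
def rmul (U : ℝ × ℝ → ℝ) (p : ℝ × ℝ) : ℝ := p.2 * U p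

/-- A radial profile `U(t, r)`, even in `r` and supported in `|r| ≤ R`, solving
`U_tt = U_rr + (2 / r) U_r - f(U)` on `[t₀, t₁]` with energy at most `e`. -/
structure RadialWave (t₀ t₁ R e : ℝ) (U : ℝ × ℝ → ℝ) : Prop where
  lt : t₀ < t₁
  R_pos : 0 < R
  smooth : ContDiff ℝ (⊤ : ℕ∞) U
  even : HasParity t₀ t₁ 1 U
  supp : VanishesOut t₀ t₁ R U
  eqn : ∀ t ∈ Set.Icc t₀ t₁, ∀ r, r * dt (dt U) (t, r) =
    r * dr (dr U) (t, r) + 2 * dr U (t, r) - r * nonlin (U (t, r))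
  energy_le : ∀ t ∈ Set.Icc t₀ t₁, ∫ r in 0..R, r ^ 2 * (1 / 2 * dt U (t, r) ^ 2
    + 1 / 2 * dr U (t, r) ^ 2 + Fpot (U (t, r))) ≤ e

section profile

variable {U : ℝ × ℝ → ℝ}

theorem contDiff_rmul (h : ContDiff ℝ (⊤ : ℕ∞) U) : ContDiff ℝ (⊤ : ℕ∞) (rmul U) :=
  contDiff_snd.mul h

theorem dt_rmul (h : ContDiff ℝ (⊤ : ℕ∞) U) : dt (rmul U) = rmul (dt U) := by
  ext ⟨t, r⟩
  exact dt_eq_of_hasDerivAt (contDiff_rmul h) ((hasDerivAt_dt h t r).const_mul r)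

theorem dr_rmul (h : ContDiff ℝ (⊤ : ℕ∞) U) : dr (rmul U) = fun p => U p + rmul (dr U) p := by
  ext ⟨t, r⟩
  refine dr_eq_of_hasDerivAt (contDiff_rmul h) ?_
  refine ((hasDerivAt_id r).mul (hasDerivAt_dr h t r)).congr_deriv ?_
  simp [rmul]

theorem dr_dr_rmul (h : ContDiff ℝ (⊤ : ℕ∞) U) :
    dr (dr (rmul U)) = fun p => 2 * dr U p + rmul (dr (dr U)) p := by
  have h1 := contDiff_dr h
  ext ⟨t, r⟩
  refine dr_eq_of_hasDerivAt (contDiff_dr (contDiff_rmul h)) ?_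
  rw [dr_rmul h]
  refine ((hasDerivAt_dr h t r).add
    ((hasDerivAt_id r).mul (hasDerivAt_dr h1 t r))).congr_deriv ?_
  simp [rmul]; ring

end profile

/-- The spacetime density `r² U⁸ log(2 + U²)`. -/
def density (U : ℝ × ℝ → ℝ) (p : ℝ × ℝ) : ℝ := p.2 ^ 2 * U p ^ 8 * Real.log (2 + U p ^ 2)

theorem continuous_density {U : ℝ × ℝ → ℝ} (h : Continuous U) : Continuous (density U) := by
  have h1 := continuous_log_two_add_sq.comp h
  exact ((continuous_snd.pow 2).mul (h.pow 8)).mul h1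

theorem density_nonneg (U : ℝ × ℝ → ℝ) (p : ℝ × ℝ) : 0 ≤ density U p := by
  have := log_two_add_sq_ge (U p)
  unfold density; positivity

theorem continuous_intervalIntegral_snd {W : ℝ × ℝ → ℝ} (hW : Continuous W) (a b : ℝ) :
    Continuous fun t => ∫ r in a..b, W (t, r) :=
  intervalIntegral.continuous_parametric_intervalIntegral_of_continuous' (f := fun t r => W (t, r))
    (by exact hW) a b

theorem intervalIntegral_swap {W : ℝ × ℝ → ℝ} (hW : Continuous W) (a b c d : ℝ) :
    ∫ t in a..b, ∫ r in c..d, W (t, r) = ∫ r in c..d, ∫ t in a..b, W (t, r) := by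
  refine intervalIntegral_intervalIntegral_swap (F := fun t r => W (t, r)) ?_
  have : IntegrableOn W (Set.uIcc a b ×ˢ Set.uIcc c d) (volume.prod volume) :=
    hW.continuousOn.integrableOn_compact (isCompact_uIcc.prod isCompact_uIcc)
  exact this.mono_set (Set.prod_mono Set.uIoc_subset_uIcc Set.uIoc_subset_uIcc)

namespace RadialWave

variable {t₀ t₁ R e : ℝ} {U : ℝ × ℝ → ℝ} (H : RadialWave t₀ t₁ R e U)
include H

theorem wave {t : ℝ} (ht : t ∈ Set.Icc t₀ t₁) (r : ℝ) : dt (dt (rmul U)) (t, r) =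
    dr (dr (rmul U)) (t, r) - r * nonlin (U (t, r)) := by
  rw [dt_rmul H.smooth, dt_rmul (contDiff_dt H.smooth), dr_dr_rmul H.smooth]
  simp only [rmul]
  linarith [H.eqn t ht r]

theorem suppRmul : VanishesOut t₀ t₁ R (rmul U) := fun t ht r hr => by
  simp [rmul, H.supp t ht r hr]

theorem zero_at {t : ℝ} (ht : t ∈ Set.Icc t₀ t₁) : U (t, R) = 0 :=
  H.supp.eq_zero H.smooth.continuous H.R_pos.le ht (le_abs_self R)

theorem dr_zero_at {t : ℝ} (ht : t ∈ Set.Icc t₀ t₁) : dr U (t, R) = 0 :=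
  (H.supp.radialDeriv H.smooth).eq_zero (contDiff_dr H.smooth).continuous H.R_pos.le ht
    (le_abs_self R)

theorem dt_zero_at {t : ℝ} (ht : t ∈ Set.Icc t₀ t₁) : dt U (t, R) = 0 :=
  (H.supp.timeDeriv H.lt H.smooth).eq_zero (contDiff_dt H.smooth).continuous H.R_pos.le ht
    (le_abs_self R)

theorem dr_zero_origin {t : ℝ} (ht : t ∈ Set.Icc t₀ t₁) : dr U (t, 0) = 0 := by
  have := H.even.radialDeriv H.smooth t ht 0
  simp at this
  linarith

theorem integral_kinetic_le {t : ℝ} (ht : t ∈ Set.Icc t₀ t₁) :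
    (∫ r in 0..R, r ^ 2 * dt U (t, r) ^ 2) + ∫ r in 0..R, r ^ 2 * dr U (t, r) ^ 2 ≤ 2 * e := by
  have h1 := (contDiff_dt H.smooth).continuous
  have h2 := (contDiff_dr H.smooth).continuous
  have h3 := H.smooth.continuous
  have h4 := continuous_Fpot
  rw [← intervalIntegral.integral_add (Continuous.intervalIntegrable (by fun_prop) _ _)
    (Continuous.intervalIntegrable (by fun_prop) _ _)]
  refine le_trans ?_ (mul_le_mul_of_nonneg_left (H.energy_le t ht) zero_le_two)
  rw [← intervalIntegral.integral_const_mul]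
  refine intervalIntegral.integral_mono_on H.R_pos.le
    (Continuous.intervalIntegrable (by fun_prop) _ _)
    (Continuous.intervalIntegrable (by fun_prop) _ _) fun r _ => ?_
  have := mul_nonneg (sq_nonneg r) (Fpot_nonneg (U (t, r)))
  nlinarith

theorem e_nonneg : 0 ≤ e := by
  have ht : t₀ ∈ Set.Icc t₀ t₁ := ⟨le_rfl, H.lt.le⟩
  have h := H.integral_kinetic_le ht
  have h1 : 0 ≤ ∫ r in 0..R, r ^ 2 * dt U (t₀, r) ^ 2 :=
    intervalIntegral.integral_nonneg H.R_pos.le fun r _ => by positivity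
  have h2 : 0 ≤ ∫ r in 0..R, r ^ 2 * dr U (t₀, r) ^ 2 :=
    intervalIntegral.integral_nonneg H.R_pos.le fun r _ => by positivity
  linarith

theorem integral_dr_le {t : ℝ} (ht : t ∈ Set.Icc t₀ t₁) :
    ∫ r in 0..R, r ^ 2 * dr U (t, r) ^ 2 ≤ 2 * e := by
  have h := H.integral_kinetic_le ht
  have h1 : 0 ≤ ∫ r in 0..R, r ^ 2 * dt U (t, r) ^ 2 :=
    intervalIntegral.integral_nonneg H.R_pos.le fun r _ => by positivity
  linarith

theorem integral_rmul_kinetic {t : ℝ} (ht : t ∈ Set.Icc t₀ t₁) :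
    ∫ r in 0..R, (dt (rmul U) (t, r) ^ 2 + dr (rmul U) (t, r) ^ 2) =
      (∫ r in 0..R, r ^ 2 * dt U (t, r) ^ 2) + ∫ r in 0..R, r ^ 2 * dr U (t, r) ^ 2 := by
  have h1 := (contDiff_dt H.smooth).continuous
  have h2 := (contDiff_dr H.smooth).continuous
  have h3 := H.smooth.continuous
  rw [dt_rmul H.smooth, dr_rmul H.smooth]
  simp only [rmul]
  rw [intervalIntegral.integral_add (Continuous.intervalIntegrable (by fun_prop) _ _)
    (Continuous.intervalIntegrable (by fun_prop) _ _),
    integral_sq_deriv_r_mul (fun r => hasDerivAt_dr H.smooth t r) (by fun_prop) (H.zero_at ht)]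
  congr 1
  congr 1; ext r; ring

theorem r_mul_sq_le_energy {t r : ℝ} (ht : t ∈ Set.Icc t₀ t₁) (h0 : 0 ≤ r) (hr : r ≤ R) :
    r * U (t, r) ^ 2 ≤ 2 * e := by
  have h2 := (contDiff_dr H.smooth).continuous
  exact (r_mul_sq_le (fun r => hasDerivAt_dr H.smooth t r) (by fun_prop) (H.zero_at ht)
    h0 hr).trans (H.integral_dr_le ht)

theorem abs_momentum_le {t : ℝ} (ht : t ∈ Set.Icc t₀ t₁) :
    |∫ r in 0..R, dt (rmul U) (t, r) * dr (rmul U) (t, r)| ≤ e := by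
  have h1 := (contDiff_dt (contDiff_rmul H.smooth)).continuous
  have h2 := (contDiff_dr (contDiff_rmul H.smooth)).continuous
  have h := H.integral_kinetic_le ht
  rw [← H.integral_rmul_kinetic ht] at h
  have h3 : ∀ σ : ℝ, σ ^ 2 = 1 →
      σ * (∫ r in 0..R, dt (rmul U) (t, r) * dr (rmul U) (t, r)) ≤ e := by
    intro σ hσ
    rw [← intervalIntegral.integral_const_mul]
    refine le_trans (intervalIntegral.integral_mono_on (g := fun r => 1 / 2 *
      (dt (rmul U) (t, r) ^ 2 + dr (rmul U) (t, r) ^ 2)) H.R_pos.le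
      (Continuous.intervalIntegrable (by fun_prop) _ _)
      (Continuous.intervalIntegrable (by fun_prop) _ _) fun r _ => ?_) ?_
    · nlinarith [sq_nonneg (dt (rmul U) (t, r) - σ * dr (rmul U) (t, r))]
    · rw [intervalIntegral.integral_const_mul]; linarith
  rw [abs_le]
  constructor
  · linarith [h3 (-1) (by norm_num)]
  · linarith [h3 1 (by norm_num)]

theorem morawetz : ∫ t in t₀..t₁, ∫ r in 0..R,
    r * (U (t, r) * nonlin (U (t, r)) - 2 * Fpot (U (t, r))) ≤ 2 * e := by
  set V := rmul U with hV
  have hVs : ContDiff ℝ (⊤ : ℕ∞) V := contDiff_rmul H.smooth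
  have c0 := H.smooth.continuous
  have c0' := (contDiff_dr H.smooth).continuous
  have c1 := (contDiff_dt hVs).continuous
  have c2 := (contDiff_dr hVs).continuous
  have c3 := (contDiff_dt (contDiff_dt hVs)).continuous
  have c4 := (contDiff_dt (contDiff_dr hVs)).continuous
  have c5 := (contDiff_dr (contDiff_dr hVs)).continuous
  have c6 := (contDiff_dr (contDiff_dt hVs)).continuous
  have c7 := continuous_Fpot
  have c8 := continuous_nonlin
  set A : ℝ × ℝ → ℝ := fun p => dt (dt V) p * dr V p + dt V p * dt (dr V) p with hA
  set B : ℝ × ℝ → ℝ := fun p => -(dt V p * dr (dt V) p + dr V p * dr (dr V) p)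
    + (2 * p.2 * Fpot (U p) + p.2 ^ 2 * (nonlin (U p) * dr U p)) with hB
  have cA : Continuous A := by fun_prop
  have hAint : ∫ t in t₀..t₁, ∫ r in 0..R, A (t, r) =
      (∫ r in 0..R, dt V (t₁, r) * dr V (t₁, r)) - ∫ r in 0..R, dt V (t₀, r) * dr V (t₀, r) := by
    rw [intervalIntegral_swap cA, ← intervalIntegral.integral_sub
      (Continuous.intervalIntegrable (by fun_prop) _ _)
      (Continuous.intervalIntegrable (by fun_prop) _ _)]
    congr 1; ext r
    exact intervalIntegral.integral_eq_sub_of_hasDerivAt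
      (f := fun t => dt V (t, r) * dr V (t, r))
      (fun t _ => (hasDerivAt_dt (contDiff_dt hVs) t r).mul (hasDerivAt_dt (contDiff_dr hVs) t r))
      (Continuous.intervalIntegrable (by fun_prop) _ _)
  have hBint : ∀ t ∈ Set.Icc t₀ t₁, 0 ≤ ∫ r in 0..R, B (t, r) := by
    intro t ht
    have hd : ∀ r, HasDerivAt (fun r => -(1 / 2 * (dt V (t, r) ^ 2 + dr V (t, r) ^ 2))
        + r ^ 2 * Fpot (U (t, r))) (B (t, r)) r := by
      intro r
      have h1 := ((hasDerivAt_dr (contDiff_dt hVs) t r).pow 2)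
      have h2 := ((hasDerivAt_dr (contDiff_dr hVs) t r).pow 2)
      have h3 := (hasDerivAt_Fpot (U (t, r))).comp r (hasDerivAt_dr H.smooth t r)
      refine ((((h1.add h2).const_mul (1 / 2)).neg).add
        ((hasDerivAt_pow 2 r).mul h3)).congr_deriv ?_
      simp [hB]; ring
    rw [intervalIntegral.integral_eq_sub_of_hasDerivAt (fun r _ => hd r)
      (Continuous.intervalIntegrable (by fun_prop) _ _)]
    have e1 : dt V (t, R) = 0 := by rw [hV, dt_rmul H.smooth]; simp [rmul, H.dt_zero_at ht]
    have e2 : dr V (t, R) = 0 := by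
      rw [hV, dr_rmul H.smooth]; simp [rmul, H.dr_zero_at ht, H.zero_at ht]
    rw [e1, e2, H.zero_at ht, Fpot_zero]
    have := sq_nonneg (dt V (t, 0))
    have := sq_nonneg (dr V (t, 0))
    simp
    linarith
  have hAB : ∀ t ∈ Set.Icc t₀ t₁, ∫ r in 0..R,
      r * (U (t, r) * nonlin (U (t, r)) - 2 * Fpot (U (t, r))) =
        -(∫ r in 0..R, A (t, r)) - ∫ r in 0..R, B (t, r) := by
    intro t ht
    rw [← intervalIntegral.integral_neg, ← intervalIntegral.integral_sub
      (Continuous.intervalIntegrable (by fun_prop) _ _)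
      (Continuous.intervalIntegrable (by fun_prop) _ _)]
    congr 1; ext r
    simp only [hA, hB]
    rw [H.wave ht r, dt_dr_comm hVs, hV, dr_rmul H.smooth]
    simp only [rmul]
    ring
  have hle : ∫ t in t₀..t₁, ∫ r in 0..R,
      r * (U (t, r) * nonlin (U (t, r)) - 2 * Fpot (U (t, r))) ≤
        ∫ t in t₀..t₁, -(∫ r in 0..R, A (t, r)) := by
    refine intervalIntegral.integral_mono_on H.lt.le
      (Continuous.intervalIntegrable (continuous_intervalIntegral_snd (W := fun p : ℝ × ℝ =>
        p.2 * (U p * nonlin (U p) - 2 * Fpot (U p))) (by fun_prop) 0 R) _ _)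
      (Continuous.intervalIntegrable (continuous_intervalIntegral_snd cA 0 R).neg _ _)
      fun t ht => ?_
    rw [hAB t ht]
    linarith [hBint t ht]
  rw [intervalIntegral.integral_neg, hAint] at hle
  have m0 := abs_le.1 (H.abs_momentum_le (t := t₀) ⟨le_rfl, H.lt.le⟩)
  have m1 := abs_le.1 (H.abs_momentum_le (t := t₁) ⟨H.lt.le, le_rfl⟩)
  linarith [m0.2, m1.1]

/-- The spacetime bound `∫∫ r² U⁸ log(2 + U²) ≤ 6 e²`. -/
theorem integral_density_le : ∫ t in t₀..t₁, ∫ r in 0..R, density U (t, r) ≤ 6 * e ^ 2 := by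
  have c0 := H.smooth.continuous
  have c7 := continuous_Fpot
  have c8 := continuous_nonlin
  have c9 := continuous_density c0
  have he := H.e_nonneg
  calc _ ≤ ∫ t in t₀..t₁, ∫ r in 0..R, (3 * e) *
        (r * (U (t, r) * nonlin (U (t, r)) - 2 * Fpot (U (t, r)))) := by
        refine intervalIntegral.integral_mono_on H.lt.le
          (Continuous.intervalIntegrable (continuous_intervalIntegral_snd c9 0 R) _ _)
          (Continuous.intervalIntegrable (continuous_intervalIntegral_snd (W := fun p : ℝ × ℝ =>
            (3 * e) * (p.2 * (U p * nonlin (U p) - 2 * Fpot (U p)))) (by fun_prop) 0 R) _ _)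
          fun t ht => ?_
        refine intervalIntegral.integral_mono_on H.R_pos.le
          (Continuous.intervalIntegrable (by fun_prop) _ _)
          (Continuous.intervalIntegrable (by fun_prop) _ _) fun r hr => ?_
        have h1 := morawetz_density_ge (U (t, r))
        have h2 := H.r_mul_sq_le_energy ht hr.1 hr.2
        have hL := log_two_add_sq_ge (U (t, r))
        have h3 : 0 ≤ r * (U (t, r) ^ 6 * Real.log (2 + U (t, r) ^ 2)) :=
          mul_nonneg hr.1 (by positivity)
        calc density U (t, r)
            = (r * U (t, r) ^ 2) * (r * (U (t, r) ^ 6 * Real.log (2 + U (t, r) ^ 2))) := by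
              simp only [density]; ring
          _ ≤ (2 * e) * (r * (U (t, r) ^ 6 * Real.log (2 + U (t, r) ^ 2))) := by gcongr
          _ = (3 * e) * (r * (2 / 3 * (U (t, r) ^ 6 * Real.log (2 + U (t, r) ^ 2)))) := by ring
          _ ≤ _ := by
            have := hr.1
            gcongr
    _ = (3 * e) * ∫ t in t₀..t₁, ∫ r in 0..R,
        (r * (U (t, r) * nonlin (U (t, r)) - 2 * Fpot (U (t, r)))) := by
        simp_rw [intervalIntegral.integral_const_mul]
    _ ≤ (3 * e) * (2 * e) := by gcongr; exact H.morawetz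
    _ = _ := by ring

end RadialWave

/-! ### Propagation of second-order regularity along characteristics -/

theorem maximal_continuous {f h : ℝ → ℝ} {a b M R : ℝ} (hab : a ≤ b) (hf : Continuous f)
    (hf0 : ∀ x, 0 ≤ f x) (hh : Continuous h) (hh0 : ∀ x, 0 ≤ h x) (hM : ∀ y, M ≤ |y| → h y = 0)
    (H : ∀ x ∈ Set.Icc a b, ∃ r > 0, r ≤ R ∧ f x * r ≤ ∫ y in (x - r)..(x + r), h y) :
    ∫ x in a..b, f x ^ 2 ≤ 128 * ∫ y in -M..M, h y ^ 2 := by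
  have h1 := strong_type_maximal (f := f) (h := h) (Set.Icc a b) R hf.measurable hf0
    hh.measurable hh0 fun x hx => by
      obtain ⟨r, hr0, hrR, hr⟩ := H x hx
      refine ⟨r, hr0, hrR, ?_⟩
      rw [← ENNReal.ofReal_mul (hf0 x), Real.closedBall_eq_Icc]
      refine (ENNReal.ofReal_le_ofReal hr).trans ?_
      rw [intervalIntegral.integral_of_le (by linarith), ← integral_Icc_eq_integral_Ioc,
        ofReal_integral_eq_lintegral_ofReal hh.integrableOn_Icc
          (Filter.Eventually.of_forall hh0)]
  have hf2 : Continuous fun x => f x ^ 2 := hf.pow 2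
  have hh2 : Continuous fun x => h x ^ 2 := hh.pow 2
  have hInt : Integrable (fun y => h y ^ 2) := by
    refine hh2.integrable_of_hasCompactSupport
      (HasCompactSupport.intro (isCompact_Icc (a := -M) (b := M)) fun y hy => ?_)
    have : M ≤ |y| := by
      by_contra hlt
      exact hy (abs_le.1 (not_le.1 hlt).le)
    simp [hM y this]
  have h2 : ∫ y, h y ^ 2 = ∫ y in -M..M, h y ^ 2 := by
    refine (intervalIntegral.integral_eq_integral_of_support_subset fun x hx => ?_).symm
    have hx' : ¬ M ≤ |x| := fun h => hx (by simp [hM x h])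
    have := abs_lt.1 (not_le.1 hx')
    exact ⟨by linarith, by linarith⟩
  rw [← h2, intervalIntegral.integral_of_le hab, ← integral_Icc_eq_integral_Ioc]
  rw [← ofReal_integral_eq_lintegral_ofReal hf2.integrableOn_Icc
      (Filter.Eventually.of_forall fun x => sq_nonneg _),
    ← ofReal_integral_eq_lintegral_ofReal hInt (Filter.Eventually.of_forall fun x => sq_nonneg _),
    show (128 : ENNReal) = ENNReal.ofReal 128 by simp, ← ENNReal.ofReal_mul (by norm_num)] at h1
  refine (ENNReal.ofReal_le_ofReal_iff ?_).1 h1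
  exact mul_nonneg (by norm_num) (integral_nonneg fun x => sq_nonneg _)

/-- Minkowski's integral inequality in `L²`. -/
theorem minkowski_sq {W : ℝ × ℝ → ℝ} {g : ℝ → ℝ} {a b c d : ℝ} (hab : a ≤ b) (hcd : c ≤ d)
    (hW : Continuous W) (hg : Continuous g) (hg0 : ∀ s, 0 ≤ g s)
    (h : ∀ s ∈ Set.Icc a b, ∫ y in c..d, W (s, y) ^ 2 ≤ g s ^ 2) :
    ∫ y in c..d, (∫ s in a..b, |W (s, y)|) ^ 2 ≤ (∫ s in a..b, g s) ^ 2 := by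
  have key : ∀ η > 0, ∫ y in c..d, (∫ s in a..b, |W (s, y)|) ^ 2 ≤
      ((∫ s in a..b, g s) + (b - a) * η) ^ 2 := by
    intro η hη
    have hρ : ∀ s, 0 < g s + η := fun s => by linarith [hg0 s]
    have hρc : Continuous fun s => Real.sqrt (g s + η) := by fun_prop
    have hinv : Continuous fun s => (g s + η)⁻¹ :=
      Continuous.inv₀ (by fun_prop) fun s => (hρ s).ne'
    have hsum : ∫ s in a..b, (g s + η) = (∫ s in a..b, g s) + (b - a) * η := by
      rw [intervalIntegral.integral_add (hg.intervalIntegrable _ _)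
        (continuous_const.intervalIntegrable _ _)]
      simp
    have hA0 : 0 ≤ ∫ s in a..b, (g s + η) :=
      intervalIntegral.integral_nonneg hab fun s _ => (hρ s).le
    have cWρ : Continuous fun p : ℝ × ℝ => (g p.1 + η)⁻¹ * W p ^ 2 := by
      have := hinv.comp continuous_fst (X := ℝ × ℝ)
      exact this.mul (hW.pow 2)
    have cWρ' : Continuous fun p : ℝ × ℝ => (g p.2 + η)⁻¹ * W (p.2, p.1) ^ 2 :=
      cWρ.comp continuous_swap
    have hpt : ∀ y, (∫ s in a..b, |W (s, y)|) ^ 2 ≤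
        (∫ s in a..b, (g s + η)) * ∫ s in a..b, (g s + η)⁻¹ * W (s, y) ^ 2 := by
      intro y
      have hc : Continuous fun s => |W (s, y)| / Real.sqrt (g s + η) :=
        Continuous.div (by fun_prop) hρc fun s => (Real.sqrt_pos.2 (hρ s)).ne'
      have := sq_integral_mul_le hab hρc hc
      convert this using 2
      · congr 1; ext s
        have := (Real.sqrt_pos.2 (hρ s)).ne'
        field_simp
      · congr 1; ext s
        rw [Real.sq_sqrt (hρ s).le]
      · congr 1; ext s
        rw [div_pow, Real.sq_sqrt (hρ s).le, sq_abs]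
        field_simp
    rw [← hsum]
    calc _ ≤ ∫ y in c..d, (∫ s in a..b, (g s + η)) * ∫ s in a..b, (g s + η)⁻¹ * W (s, y) ^ 2 := by
          refine intervalIntegral.integral_mono_on hcd (Continuous.intervalIntegrable ?_ _ _)
            (Continuous.intervalIntegrable ?_ _ _) fun y _ => hpt y
          · exact (continuous_intervalIntegral_snd (W := fun p => |W (p.2, p.1)|)
              (by fun_prop) a b).pow 2
          · exact continuous_const.mul (continuous_intervalIntegral_snd cWρ' a b)
      _ = (∫ s in a..b, (g s + η)) * ∫ s in a..b, ∫ y in c..d, (g s + η)⁻¹ * W (s, y) ^ 2 := by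
          rw [intervalIntegral.integral_const_mul, intervalIntegral_swap cWρ]
      _ ≤ (∫ s in a..b, (g s + η)) * ∫ s in a..b, (g s + η) := by
          gcongr
          refine intervalIntegral.integral_mono_on hab
            ((continuous_intervalIntegral_snd cWρ c d).intervalIntegrable _ _)
            (Continuous.intervalIntegrable (by fun_prop) _ _) fun s hs => ?_
          rw [intervalIntegral.integral_const_mul, inv_mul_le_iff₀ (hρ s)]
          nlinarith [h s hs, hg0 s]
      _ = _ := by ring
  have hlim : Filter.Tendsto (fun η => ((∫ s in a..b, g s) + (b - a) * η) ^ 2)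
      (nhdsWithin 0 (Set.Ioi 0)) (nhds ((∫ s in a..b, g s) ^ 2)) := by
    have hc : Continuous fun η => ((∫ s in a..b, g s) + (b - a) * η) ^ 2 := by fun_prop
    have := hc.tendsto 0
    simp only [mul_zero, add_zero] at this
    exact this.mono_left nhdsWithin_le_nhds
  refine ge_of_tendsto hlim ?_
  filter_upwards [self_mem_nhdsWithin] with η hη using key η hη

theorem integral_symm_eq {P : ℝ → ℝ} (hP : Continuous P) (R : ℝ) :
    ∫ r in -R..R, P r = ∫ r in 0..R, (P r + P (-r)) := by
  have h0 : Continuous fun r => P (-r) := hP.comp continuous_neg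
  have h1 : ∫ r in 0..R, P (-r) = ∫ r in -R..0, P r := by
    rw [intervalIntegral.integral_comp_neg]; simp
  rw [intervalIntegral.integral_add (hP.intervalIntegrable _ _) (h0.intervalIntegrable _ _), h1,
    add_comm, intervalIntegral.integral_add_adjacent_intervals (hP.intervalIntegrable _ _)
      (hP.intervalIntegrable _ _)]

/-- The radial derivative of `V_t + V_r`, where `V = r U`. -/
def charDeriv (U : ℝ × ℝ → ℝ) : ℝ × ℝ → ℝ := dr fun p => dt (rmul U) p + dr (rmul U) p

/-- The radial derivative of `-r f(U)`. -/
def forcing (U : ℝ × ℝ → ℝ) (p : ℝ × ℝ) : ℝ := -(nonlin (U p) + p.2 * dnonlin (U p) * dr U p)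

/-- The square of the second-order energy. -/
def energy₂ (R : ℝ) (U : ℝ × ℝ → ℝ) (t : ℝ) : ℝ := ∫ r in -R..R, charDeriv U (t, r) ^ 2

theorem charDeriv_eq {U : ℝ × ℝ → ℝ} (h : ContDiff ℝ (⊤ : ℕ∞) U) (p : ℝ × ℝ) :
    charDeriv U p = dr (dt (rmul U)) p + dr (dr (rmul U)) p := by
  obtain ⟨t, r⟩ := p
  have hV := contDiff_rmul h
  exact dr_eq_of_hasDerivAt ((contDiff_dt hV).add (contDiff_dr hV))
    ((hasDerivAt_dr (contDiff_dt hV) t r).add (hasDerivAt_dr (contDiff_dr hV) t r))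

theorem continuous_charDeriv {U : ℝ × ℝ → ℝ} (h : ContDiff ℝ (⊤ : ℕ∞) U) :
    Continuous (charDeriv U) := by
  have hV := contDiff_rmul h
  exact (contDiff_dr ((contDiff_dt hV).add (contDiff_dr hV))).continuous

theorem continuous_forcing {U : ℝ × ℝ → ℝ} (h : ContDiff ℝ (⊤ : ℕ∞) U) :
    Continuous (forcing U) := by
  have h1 := (contDiff_dr h).continuous
  have h2 := continuous_nonlin
  have h3 := continuous_dnonlin
  unfold forcing
  fun_prop

theorem continuous_energy₂ {U : ℝ × ℝ → ℝ} (h : ContDiff ℝ (⊤ : ℕ∞) U) (R : ℝ) :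
    Continuous (energy₂ R U) :=
  continuous_intervalIntegral_snd ((continuous_charDeriv h).pow 2) _ _

namespace RadialWave

variable {t₀ t₁ R e : ℝ} {U : ℝ × ℝ → ℝ} (H : RadialWave t₀ t₁ R e U)
include H

theorem hasDerivAt_charDeriv {t : ℝ} (ht : t ∈ Set.Icc t₀ t₁) (y : ℝ) :
    HasDerivAt (fun s => charDeriv U (s, y - s)) (forcing U (t, y - t)) t := by
  have hV := contDiff_rmul H.smooth
  set Q : ℝ × ℝ → ℝ := fun p => dt (rmul U) p + dr (rmul U) p with hQdef
  have hQ : ContDiff ℝ (⊤ : ℕ∞) Q := (contDiff_dt hV).add (contDiff_dr hV)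
  have h1 := hasDerivAt_char (contDiff_dr hQ) y t
  refine h1.congr_deriv ?_
  rw [dt_dr_comm hQ]
  have h2 : ∀ r, dt Q (t, r) - dr Q (t, r) = -(r * nonlin (U (t, r))) := by
    intro r
    have e1 : dt Q (t, r) = dt (dt (rmul U)) (t, r) + dt (dr (rmul U)) (t, r) :=
      dt_eq_of_hasDerivAt hQ
        ((hasDerivAt_dt (contDiff_dt hV) t r).add (hasDerivAt_dt (contDiff_dr hV) t r))
    have e2 : dr Q (t, r) = dr (dt (rmul U)) (t, r) + dr (dr (rmul U)) (t, r) :=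
      charDeriv_eq H.smooth (t, r)
    rw [e1, e2, H.wave ht, dt_dr_comm hV]; ring
  have h3 := (hasDerivAt_dr (contDiff_dt hQ) t (y - t)).sub
    (hasDerivAt_dr (contDiff_dr hQ) t (y - t))
  have h4 : HasDerivAt (fun r => -(r * nonlin (U (t, r)))) (forcing U (t, y - t)) (y - t) := by
    have := ((hasDerivAt_id (y - t)).mul
      ((hasDerivAt_nonlin _).comp (y - t) (hasDerivAt_dr H.smooth t (y - t)))).neg
    refine this.congr_deriv ?_
    simp [forcing]; ring
  have h5 : (fun r => -(r * nonlin (U (t, r)))) = fun r => dt Q (t, r) - dr Q (t, r) :=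
    funext fun r => (h2 r).symm
  rw [h5] at h4
  exact h3.unique h4

theorem suppCharDeriv {t r : ℝ} (ht : t ∈ Set.Icc t₀ t₁) (hr : R ≤ |r|) :
    charDeriv U (t, r) = 0 := by
  have hV := contDiff_rmul H.smooth
  have h1 := ((H.suppRmul.timeDeriv H.lt hV).radialDeriv (contDiff_dt hV)).eq_zero
    (contDiff_dr (contDiff_dt hV)).continuous H.R_pos.le ht hr
  have h2 := ((H.suppRmul.radialDeriv hV).radialDeriv (contDiff_dr hV)).eq_zero
    (contDiff_dr (contDiff_dr hV)).continuous H.R_pos.le ht hr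
  rw [charDeriv_eq H.smooth, h1, h2, add_zero]

theorem suppForcing {t r : ℝ} (ht : t ∈ Set.Icc t₀ t₁) (hr : R ≤ |r|) :
    forcing U (t, r) = 0 := by
  have h1 := H.supp.eq_zero H.smooth.continuous H.R_pos.le ht hr
  simp [forcing, h1, nonlin, dnonlin]

theorem parityRmul : HasParity t₀ t₁ (-1) (rmul U) := fun t ht r => by
  have := H.even t ht r
  simp only [rmul, this]; ring

theorem dr_dr_eq {t : ℝ} (ht : t ∈ Set.Icc t₀ t₁) (r : ℝ) :
    dr (dr (rmul U)) (t, r) = 1 / 2 * (charDeriv U (t, r) - charDeriv U (t, -r)) := by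
  have hV := contDiff_rmul H.smooth
  have h1 := (H.parityRmul.timeDeriv H.lt hV).radialDeriv (contDiff_dt hV) t ht r
  have h2 := (H.parityRmul.radialDeriv hV).radialDeriv (contDiff_dr hV) t ht r
  rw [charDeriv_eq H.smooth, charDeriv_eq H.smooth, h1, h2]; ring

theorem integral_dr_dr_le {t : ℝ} (ht : t ∈ Set.Icc t₀ t₁) :
    ∫ r in 0..R, dr (dr (rmul U)) (t, r) ^ 2 ≤ 1 / 2 * energy₂ R U t := by
  have hP := continuous_charDeriv H.smooth
  have c5 := (contDiff_dr (contDiff_dr (contDiff_rmul H.smooth))).continuous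
  unfold energy₂
  rw [integral_symm_eq (P := fun r => charDeriv U (t, r) ^ 2) (by fun_prop) R,
    ← intervalIntegral.integral_const_mul]
  refine intervalIntegral.integral_mono_on H.R_pos.le
    (Continuous.intervalIntegrable (by fun_prop) _ _)
    (Continuous.intervalIntegrable (by fun_prop) _ _) fun r _ => ?_
  rw [H.dr_dr_eq ht]
  nlinarith [sq_nonneg (charDeriv U (t, r) + charDeriv U (t, -r))]

theorem energy₂_eq {t : ℝ} (ht : t ∈ Set.Icc t₀ t₁) : energy₂ R U t =
    2 * ∫ r in 0..R, (dr (dt (rmul U)) (t, r) ^ 2 + dr (dr (rmul U)) (t, r) ^ 2) := by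
  have hV := contDiff_rmul H.smooth
  have hP := continuous_charDeriv H.smooth
  unfold energy₂
  rw [integral_symm_eq (P := fun r => charDeriv U (t, r) ^ 2) (by fun_prop) R,
    ← intervalIntegral.integral_const_mul]
  congr 1; ext r
  have h1 := (H.parityRmul.timeDeriv H.lt hV).radialDeriv (contDiff_dt hV) t ht r
  have h2 := (H.parityRmul.radialDeriv hV).radialDeriv (contDiff_dr hV) t ht r
  rw [charDeriv_eq H.smooth, charDeriv_eq H.smooth, h1, h2]; ring

/-- The sup norm is controlled by the two energies. -/
theorem sq_le_energies {t r : ℝ} (ht : t ∈ Set.Icc t₀ t₁) (h0 : 0 ≤ r) (hr : r ≤ R) :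
    U (t, r) ^ 2 ≤ 8 * e + energy₂ R U t := by
  have c1 := (contDiff_dr H.smooth).continuous
  have c2 := (contDiff_dr (contDiff_dr H.smooth)).continuous
  have h1 := sq_le_integral (fun r => hasDerivAt_dr H.smooth t r) (by fun_prop) (H.zero_at ht) h0 hr
  have h2 := hardy H.R_pos.le (fun r => hasDerivAt_dr H.smooth t r) (by fun_prop) (H.zero_at ht)
  have h3 := H.integral_dr_le ht
  have h4 := integral_sq_second_deriv_r_mul (fun r => hasDerivAt_dr (contDiff_dr H.smooth) t r)
    (by fun_prop) (H.dr_zero_at ht)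
  have h5 := H.integral_dr_dr_le ht
  rw [dr_dr_rmul H.smooth] at h5
  simp only [rmul] at h5
  rw [h4] at h5
  have h6 : ∫ r in 0..R, dr U (t, r) ^ 2 ≤
      ∫ r in 0..R, (r ^ 2 * dr (dr U) (t, r) ^ 2 + 2 * dr U (t, r) ^ 2) := by
    refine intervalIntegral.integral_mono_on H.R_pos.le
      (Continuous.intervalIntegrable (by fun_prop) _ _)
      (Continuous.intervalIntegrable (by fun_prop) _ _) fun r _ => ?_
    nlinarith [sq_nonneg (r * dr (dr U) (t, r)), sq_nonneg (dr U (t, r))]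
  have h7 : 0 ≤ energy₂ R U t :=
    intervalIntegral.integral_nonneg (by linarith [H.R_pos]) fun r _ => sq_nonneg _
  linarith

theorem abs_dr_mul_le {t r : ℝ} (ht : t ∈ Set.Icc t₀ t₁) (h0 : 0 < r) :
    |dr U (t, r)| * r ≤ ∫ s in -r..r, |charDeriv U (t, s)| := by
  have c2 := (contDiff_dr (contDiff_dr H.smooth)).continuous
  have cP := continuous_charDeriv H.smooth
  have c5 := (contDiff_dr (contDiff_dr (contDiff_rmul H.smooth))).continuous
  have h1 := sq_mul_deriv_eq_integral (fun r => hasDerivAt_dr (contDiff_dr H.smooth) t r)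
    (by fun_prop) r
  have h2 : ∀ s, 2 * dr U (t, s) + s * dr (dr U) (t, s) = dr (dr (rmul U)) (t, s) := by
    intro s; rw [dr_dr_rmul H.smooth]; rfl
  simp only [h2] at h1
  have h3 : r ^ 2 * |dr U (t, r)| ≤ r * ∫ s in 0..r, |dr (dr (rmul U)) (t, s)| := by
    calc r ^ 2 * |dr U (t, r)| = |r ^ 2 * dr U (t, r)| := by
          rw [abs_mul, abs_of_nonneg (sq_nonneg r)]
      _ ≤ ∫ s in 0..r, |s * dr (dr (rmul U)) (t, s)| := by
          rw [h1]; exact intervalIntegral.abs_integral_le_integral_abs h0.le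
      _ ≤ ∫ s in 0..r, r * |dr (dr (rmul U)) (t, s)| := by
          refine intervalIntegral.integral_mono_on h0.le
            (Continuous.intervalIntegrable (by fun_prop) _ _)
            (Continuous.intervalIntegrable (by fun_prop) _ _) fun s hs => ?_
          rw [abs_mul, abs_of_nonneg hs.1]
          have := hs.2
          gcongr
      _ = _ := intervalIntegral.integral_const_mul _ _
  have h4 : ∫ s in 0..r, |dr (dr (rmul U)) (t, s)| ≤ ∫ s in -r..r, |charDeriv U (t, s)| := by
    have e1 : ∫ s in 0..r, |charDeriv U (t, -s)| = ∫ s in -r..0, |charDeriv U (t, s)| := by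
      rw [intervalIntegral.integral_comp_neg (f := fun s => |charDeriv U (t, s)|)]; simp
    rw [← intervalIntegral.integral_add_adjacent_intervals (a := -r) (b := 0) (c := r)
      (Continuous.intervalIntegrable (by fun_prop) _ _)
      (Continuous.intervalIntegrable (by fun_prop) _ _), ← e1,
      ← intervalIntegral.integral_add (Continuous.intervalIntegrable (by fun_prop) _ _)
      (Continuous.intervalIntegrable (by fun_prop) _ _)]
    refine intervalIntegral.integral_mono_on h0.le
      (Continuous.intervalIntegrable (by fun_prop) _ _)
      (Continuous.intervalIntegrable (by fun_prop) _ _) fun s hs => ?_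
    rw [H.dr_dr_eq ht, abs_le]
    constructor <;>
    linarith [neg_abs_le (charDeriv U (t, s)), le_abs_self (charDeriv U (t, s)),
      neg_abs_le (charDeriv U (t, -s)), le_abs_self (charDeriv U (t, -s))]
  have h5 : r * (|dr U (t, r)| * r) ≤ r * ∫ s in -r..r, |charDeriv U (t, s)| := by
    calc _ = r ^ 2 * |dr U (t, r)| := by ring
      _ ≤ _ := h3
      _ ≤ _ := by gcongr
  exact le_of_mul_le_mul_left h5 h0

theorem integral_forcing_sq_le {t Λ m : ℝ} (ht : t ∈ Set.Icc t₀ t₁)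
    (hΛ : ∀ r ∈ Set.Icc 0 R, Real.log (2 + U (t, r) ^ 2) ≤ Λ)
    (hm : ∀ r ∈ Set.Icc 0 R, |dr U (t, r)| ≤ m) :
    ∫ r in -R..R, forcing U (t, r) ^ 2 ≤ 1280 * Λ * (∫ r in 0..R, density U (t, r)) * m ^ 2 := by
  have cU := H.smooth.continuous
  have c1 := (contDiff_dr H.smooth).continuous
  have cG := continuous_forcing H.smooth
  have cd := continuous_density cU
  have cn := continuous_nonlin
  have cdn := continuous_dnonlin
  have hpar : ∀ r, forcing U (t, -r) = forcing U (t, r) := by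
    intro r
    have h1 := H.even t ht r
    have h2 := H.even.radialDeriv H.smooth t ht r
    simp only [forcing, h1, h2, one_mul]; ring
  have hhardy := hardy H.R_pos.le (U := fun r => nonlin (U (t, r)))
    (U' := fun r => dnonlin (U (t, r)) * dr U (t, r))
    (fun r => (hasDerivAt_nonlin _).comp r (hasDerivAt_dr H.smooth t r)) (by fun_prop)
    (by simp [H.zero_at ht, nonlin])
  rw [integral_symm_eq (P := fun r => forcing U (t, r) ^ 2) (by fun_prop) R]
  calc _ ≤ ∫ r in 0..R, (4 * nonlin (U (t, r)) ^ 2 +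
        4 * (r ^ 2 * (dnonlin (U (t, r)) * dr U (t, r)) ^ 2)) := by
        refine intervalIntegral.integral_mono_on H.R_pos.le
          (Continuous.intervalIntegrable (by fun_prop) _ _)
          (Continuous.intervalIntegrable (by fun_prop) _ _) fun r _ => ?_
        rw [hpar]
        simp only [forcing]
        nlinarith [sq_nonneg (nonlin (U (t, r)) - r * dnonlin (U (t, r)) * dr U (t, r))]
    _ = 4 * (∫ r in 0..R, nonlin (U (t, r)) ^ 2) +
        4 * ∫ r in 0..R, r ^ 2 * (dnonlin (U (t, r)) * dr U (t, r)) ^ 2 := by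
        rw [intervalIntegral.integral_add (Continuous.intervalIntegrable (by fun_prop) _ _)
          (Continuous.intervalIntegrable (by fun_prop) _ _), intervalIntegral.integral_const_mul,
          intervalIntegral.integral_const_mul]
    _ ≤ 20 * ∫ r in 0..R, r ^ 2 * (dnonlin (U (t, r)) * dr U (t, r)) ^ 2 := by linarith
    _ ≤ 20 * ∫ r in 0..R, 64 * Λ * m ^ 2 * density U (t, r) := by
        gcongr
        refine intervalIntegral.integral_mono_on H.R_pos.le
          (Continuous.intervalIntegrable (by fun_prop) _ _)
          (Continuous.intervalIntegrable (by fun_prop) _ _) fun r hr => ?_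
        have hL2 := hΛ r hr
        have hd := abs_dnonlin_le (U (t, r))
        have hm' := hm r hr
        have h1 : (dnonlin (U (t, r)) * dr U (t, r)) ^ 2 ≤
            (8 * U (t, r) ^ 4 * Real.log (2 + U (t, r) ^ 2)) ^ 2 * m ^ 2 := by
          rw [mul_pow, ← sq_abs (dnonlin _), ← sq_abs (dr U _)]
          gcongr
        calc _ ≤ r ^ 2 * ((8 * U (t, r) ^ 4 * Real.log (2 + U (t, r) ^ 2)) ^ 2 * m ^ 2) := by
              gcongr
          _ = 64 * Real.log (2 + U (t, r) ^ 2) * m ^ 2 * density U (t, r) := by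
              simp only [density]; ring
          _ ≤ _ := by
              have := density_nonneg U (t, r)
              gcongr
    _ = _ := by rw [intervalIntegral.integral_const_mul]; ring

end RadialWave

/-- A bound for `|charDeriv U|` on `[a, b]` along the characteristic `t + r = y`. -/
def charBound (U : ℝ × ℝ → ℝ) (a b y : ℝ) : ℝ :=
  |charDeriv U (a, y - a)| + ∫ s in a..b, |forcing U (s, y - s)|

theorem continuous_charBound {U : ℝ × ℝ → ℝ} (h : ContDiff ℝ (⊤ : ℕ∞) U) (a b : ℝ) :
    Continuous (charBound U a b) := by
  have cP := continuous_charDeriv h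
  have cG := continuous_forcing h
  have h1 : Continuous fun y => |charDeriv U (a, y - a)| := by fun_prop
  exact h1.add (continuous_intervalIntegral_snd (W := fun p => |forcing U (p.2, p.1 - p.2)|)
    (by fun_prop) a b)

theorem charBound_nonneg (U : ℝ × ℝ → ℝ) {a b : ℝ} (hab : a ≤ b) (y : ℝ) :
    0 ≤ charBound U a b y :=
  add_nonneg (abs_nonneg _) (intervalIntegral.integral_nonneg hab fun _ _ => abs_nonneg _)

/-- The `L²` norm in space of the forcing term. -/
def forcingNorm (R : ℝ) (U : ℝ × ℝ → ℝ) (s : ℝ) : ℝ := √(∫ r in -R..R, forcing U (s, r) ^ 2)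

theorem continuous_forcingNorm {U : ℝ × ℝ → ℝ} (h : ContDiff ℝ (⊤ : ℕ∞) U) (R : ℝ) :
    Continuous (forcingNorm R U) :=
  (continuous_intervalIntegral_snd ((continuous_forcing h).pow 2) _ _).sqrt

theorem integral_shift_eq {t₀ t₁ R : ℝ} {W : ℝ → ℝ} (hW : ∀ r, R ≤ |r| → W r = 0) {s : ℝ}
    (hs : s ∈ Set.Icc t₀ t₁) :
    ∫ y in -(R + |t₀| + |t₁|)..(R + |t₀| + |t₁|), W (y - s) = ∫ r in -R..R, W r := by
  rw [intervalIntegral.integral_comp_sub_right]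
  have h1 := abs_nonneg t₀
  have h2 := abs_nonneg t₁
  refine intervalIntegral_eq_of_vanish hW ?_ ?_ <;>
  linarith [hs.1, hs.2, neg_abs_le t₀, le_abs_self t₁]

namespace RadialWave

variable {t₀ t₁ R e : ℝ} {U : ℝ × ℝ → ℝ} (H : RadialWave t₀ t₁ R e U)
include H

theorem forcingNorm_sq (s : ℝ) : forcingNorm R U s ^ 2 = ∫ r in -R..R, forcing U (s, r) ^ 2 :=
  Real.sq_sqrt (intervalIntegral.integral_nonneg (by linarith [H.R_pos]) fun _ _ => sq_nonneg _)

variable {a b : ℝ} (ha : t₀ ≤ a) (hb : b ≤ t₁)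
include ha hb

theorem abs_charDeriv_le {t : ℝ} (hat : a ≤ t) (htb : t ≤ b) (r : ℝ) :
    |charDeriv U (t, r)| ≤ charBound U a b (r + t) := by
  have cG := continuous_forcing H.smooth
  have h1 : ∫ s in a..t, forcing U (s, r + t - s) =
      charDeriv U (t, r + t - t) - charDeriv U (a, r + t - a) := by
    refine intervalIntegral.integral_eq_sub_of_hasDerivAt
      (f := fun s => charDeriv U (s, r + t - s)) (fun s hs => ?_)
      (Continuous.intervalIntegrable (by fun_prop) _ _)
    rw [Set.uIcc_of_le hat] at hs
    exact H.hasDerivAt_charDeriv ⟨ha.trans hs.1, hs.2.trans (htb.trans hb)⟩ _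
  have h2 : |∫ s in a..t, forcing U (s, r + t - s)| ≤ ∫ s in a..b, |forcing U (s, r + t - s)| :=
    (intervalIntegral.abs_integral_le_integral_abs hat).trans
      (intervalIntegral.integral_mono_interval le_rfl hat htb
        (Filter.Eventually.of_forall fun _ => abs_nonneg _)
        (Continuous.intervalIntegrable (by fun_prop) _ _))
  rw [h1, add_sub_cancel_right] at h2
  have h3 := abs_sub_abs_le_abs_sub (charDeriv U (t, r)) (charDeriv U (a, r + t - a))
  unfold charBound
  linarith

theorem charBound_eq_zero (hab : a ≤ b) {y : ℝ} (hy : R + |t₀| + |t₁| ≤ |y|) :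
    charBound U a b y = 0 := by
  have key : ∀ s ∈ Set.Icc t₀ t₁, R ≤ |y - s| := by
    intro s hs
    have h1 : |s| ≤ |t₀| + |t₁| := by
      rw [abs_le]
      constructor <;> linarith [hs.1, hs.2, neg_abs_le t₀, le_abs_self t₁, abs_nonneg t₀,
        abs_nonneg t₁]
    linarith [abs_sub_abs_le_abs_sub y s]
  have h1 : ∫ s in a..b, |forcing U (s, y - s)| = ∫ s in a..b, (0:ℝ) := by
    refine intervalIntegral.integral_congr fun s hs => ?_
    rw [Set.uIcc_of_le hab] at hs
    have hs' : s ∈ Set.Icc t₀ t₁ := ⟨ha.trans hs.1, hs.2.trans hb⟩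
    simp [H.suppForcing hs' (key s hs')]
  have ha' : a ∈ Set.Icc t₀ t₁ := ⟨ha, hab.trans hb⟩
  simp [charBound, h1, H.suppCharDeriv ha' (key a ha')]

theorem integral_charBound_sq_le (hab : a ≤ b) :
    ∫ y in -(R + |t₀| + |t₁|)..(R + |t₀| + |t₁|), charBound U a b y ^ 2 ≤
      2 * energy₂ R U a + 2 * (∫ s in a..b, forcingNorm R U s) ^ 2 := by
  have cG := continuous_forcing H.smooth
  have cP := continuous_charDeriv H.smooth
  have hM : -(R + |t₀| + |t₁|) ≤ R + |t₀| + |t₁| := by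
    linarith [abs_nonneg t₀, abs_nonneg t₁, H.R_pos]
  have hmem : ∀ s ∈ Set.Icc a b, s ∈ Set.Icc t₀ t₁ := fun s hs => ⟨ha.trans hs.1, hs.2.trans hb⟩
  have e1 : ∫ y in -(R + |t₀| + |t₁|)..(R + |t₀| + |t₁|), charDeriv U (a, y - a) ^ 2 =
      energy₂ R U a :=
    integral_shift_eq (W := fun r => charDeriv U (a, r) ^ 2)
      (fun r hr => by simp [H.suppCharDeriv (hmem a ⟨le_rfl, hab⟩) hr]) (hmem a ⟨le_rfl, hab⟩)
  have e2 := minkowski_sq (W := fun p => forcing U (p.1, p.2 - p.1)) hab hM (by fun_prop)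
    (continuous_forcingNorm H.smooth R) (fun s => Real.sqrt_nonneg _) fun s hs => by
      rw [H.forcingNorm_sq]
      exact (integral_shift_eq (W := fun r => forcing U (s, r) ^ 2)
        (fun r hr => by simp [H.suppForcing (hmem s hs) hr]) (hmem s hs)).le
  calc _ ≤ ∫ y in -(R + |t₀| + |t₁|)..(R + |t₀| + |t₁|), (2 * charDeriv U (a, y - a) ^ 2 +
        2 * (∫ s in a..b, |forcing U (s, y - s)|) ^ 2) := by
        refine intervalIntegral.integral_mono_on hM
          (((continuous_charBound H.smooth a b).pow 2).intervalIntegrable _ _)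
          (Continuous.intervalIntegrable (by fun_prop) _ _) fun y _ => ?_
        unfold charBound
        nlinarith [sq_abs (charDeriv U (a, y - a)),
          sq_nonneg (|charDeriv U (a, y - a)| - ∫ s in a..b, |forcing U (s, y - s)|)]
    _ = 2 * energy₂ R U a + 2 * ∫ y in -(R + |t₀| + |t₁|)..(R + |t₀| + |t₁|),
        (∫ s in a..b, |forcing U (s, y - s)|) ^ 2 := by
        rw [intervalIntegral.integral_add (Continuous.intervalIntegrable (by fun_prop) _ _)
          (Continuous.intervalIntegrable (by fun_prop) _ _), intervalIntegral.integral_const_mul,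
          intervalIntegral.integral_const_mul, e1]
    _ ≤ _ := by linarith

theorem energy₂_le_integral_charBound {t : ℝ} (hat : a ≤ t) (htb : t ≤ b) :
    energy₂ R U t ≤
      ∫ y in -(R + |t₀| + |t₁|)..(R + |t₀| + |t₁|), charBound U a b y ^ 2 := by
  have cP := continuous_charDeriv H.smooth
  have cB := continuous_charBound H.smooth a b
  have h1 := abs_nonneg t₀
  have h2 := abs_nonneg t₁
  calc energy₂ R U t ≤ ∫ r in -R..R, charBound U a b (r + t) ^ 2 := by
        refine intervalIntegral.integral_mono_on (by linarith [H.R_pos])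
          (Continuous.intervalIntegrable (by fun_prop) _ _)
          (Continuous.intervalIntegrable (by fun_prop) _ _) fun r _ => ?_
        rw [← sq_abs (charDeriv U _)]
        have := H.abs_charDeriv_le ha hb hat htb r
        gcongr
    _ = ∫ y in (-R + t)..(R + t), charBound U a b y ^ 2 :=
        intervalIntegral.integral_comp_add_right (fun y => charBound U a b y ^ 2) t
    _ ≤ _ := by
        refine intervalIntegral.integral_mono_interval ?_ ?_ ?_
          (Filter.Eventually.of_forall fun _ => sq_nonneg _)
          ((cB.pow 2).intervalIntegrable _ _) <;>
        linarith [H.R_pos, neg_abs_le t₀, le_abs_self t₁]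

theorem exists_radius {t m : ℝ} (hat : a ≤ t) (htb : t ≤ b)
    (hm : ∀ n, (∀ r ∈ Set.Icc 0 R, |dr U (t, r)| ≤ n) → m ≤ n) :
    ∃ r > 0, r ≤ R ∧ m * r ≤ ∫ y in (t - r)..(t + r), charBound U a b y := by
  have c1 := (contDiff_dr H.smooth).continuous
  have cB := continuous_charBound H.smooth a b
  have cP := continuous_charDeriv H.smooth
  have ht : t ∈ Set.Icc t₀ t₁ := ⟨ha.trans hat, htb.trans hb⟩
  obtain ⟨r, hr, hmax⟩ := isCompact_Icc.exists_isMaxOn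
    (Set.nonempty_Icc.2 H.R_pos.le) (f := fun r => |dr U (t, r)|) (by fun_prop)
  have hmr : m ≤ |dr U (t, r)| := hm _ fun r' hr' => hmax hr'
  rcases hr.1.eq_or_lt with h0 | h0
  · refine ⟨R, H.R_pos, le_rfl, ?_⟩
    have h1 : dr U (t, 0) = 0 := H.dr_zero_origin ht
    rw [← h0, h1, abs_zero] at hmr
    have : 0 ≤ ∫ y in (t - R)..(t + R), charBound U a b y :=
      intervalIntegral.integral_nonneg (by linarith [H.R_pos]) fun y _ =>
        charBound_nonneg U (hat.trans htb) y
    nlinarith [H.R_pos]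
  · refine ⟨r, h0, hr.2, ?_⟩
    calc m * r ≤ |dr U (t, r)| * r := by gcongr
      _ ≤ ∫ s in -r..r, |charDeriv U (t, s)| := H.abs_dr_mul_le ht h0
      _ ≤ ∫ s in -r..r, charBound U a b (s + t) :=
          intervalIntegral.integral_mono_on (by linarith)
            (Continuous.intervalIntegrable (by fun_prop) _ _)
            (Continuous.intervalIntegrable (by fun_prop) _ _) fun s _ =>
            H.abs_charDeriv_le ha hb hat htb s
      _ = _ := by
          rw [intervalIntegral.integral_comp_add_right]
          congr 1 <;> ring

/-- If the space-time integral of the density is small compared with the size of the logarithm,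
then the second-order energy at most quadruples. -/
theorem energy₂_le_four_mul (hab : a ≤ b) {Λ : ℝ} (hΛ0 : 0 ≤ Λ)
    (hΛ : ∀ t ∈ Set.Icc a b, ∀ r ∈ Set.Icc 0 R, Real.log (2 + U (t, r) ^ 2) ≤ Λ)
    (hsmall : 1280 * Λ * (∫ t in a..b, ∫ r in 0..R, density U (t, r)) ≤ 1 / 1024)
    {t : ℝ} (hat : a ≤ t) (htb : t ≤ b) :
    energy₂ R U t ≤ 4 * energy₂ R U a := by
  set M := R + |t₀| + |t₁| with hMdef
  set A := ∫ s in a..b, forcingNorm R U s with hA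
  set δ : ℝ → ℝ := fun t => ∫ r in 0..R, density U (t, r) with hδ
  have cd : Continuous δ :=
    continuous_intervalIntegral_snd (continuous_density H.smooth.continuous) _ _
  have hδ0 : ∀ t, 0 ≤ δ t := fun t => intervalIntegral.integral_nonneg H.R_pos.le fun r _ =>
    density_nonneg U (t, r)
  obtain ⟨ε, hε, hεb⟩ : ∃ ε > 0, ε * (b - a) ≤ 1 / 1024 := by
    refine ⟨1 / 1024 / (b - a + 1), by have := sub_nonneg.2 hab; positivity, ?_⟩
    rw [div_mul_eq_mul_div, div_le_iff₀ (by linarith)]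
    linarith
  set ψ : ℝ → ℝ := fun t => 1280 * Λ * δ t + ε with hψ
  have hψ0 : ∀ t, 0 < ψ t := fun t => by
    have := hδ0 t
    simp only [hψ]; positivity
  have cψ : Continuous ψ := by fun_prop
  have cg := continuous_forcingNorm H.smooth R
  have hg0 : ∀ s, 0 ≤ forcingNorm R U s := fun s => Real.sqrt_nonneg _
  have hs0 : ∀ t, √(ψ t) ≠ 0 := fun t => (Real.sqrt_pos.2 (hψ0 t)).ne'
  set f : ℝ → ℝ := fun t => forcingNorm R U t / √(ψ t) with hf
  have cf : Continuous f := cg.div cψ.sqrt hs0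
  have hf0 : ∀ t, 0 ≤ f t := fun t => div_nonneg (hg0 t) (Real.sqrt_nonneg _)
  have hmax := maximal_continuous (h := charBound U a b) (M := M) (R := R) hab cf hf0
    (continuous_charBound H.smooth a b) (charBound_nonneg U hab)
    (fun y hy => H.charBound_eq_zero ha hb hab hy) fun t ht => by
      refine H.exists_radius ha hb ht.1 ht.2 fun n hn => ?_
      have ht' : t ∈ Set.Icc t₀ t₁ := ⟨ha.trans ht.1, ht.2.trans hb⟩
      have h1 := H.integral_forcing_sq_le ht' (hΛ t ht) hn
      have hn0 : 0 ≤ n := (abs_nonneg _).trans (hn 0 ⟨le_rfl, H.R_pos.le⟩)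
      rw [hf, div_le_iff₀ (Real.sqrt_pos.2 (hψ0 t))]
      refine Real.sqrt_le_iff.2 ⟨by positivity, ?_⟩
      rw [mul_pow, Real.sq_sqrt (hψ0 t).le]
      simp only [hψ]
      nlinarith [sq_nonneg n, mul_nonneg hε.le (sq_nonneg n)]
  have hψint : ∫ t in a..b, ψ t ≤ 1 / 512 := by
    have : ∫ t in a..b, ψ t = 1280 * Λ * (∫ t in a..b, δ t) + ε * (b - a) := by
      simp only [hψ]
      rw [intervalIntegral.integral_add (Continuous.intervalIntegrable (by fun_prop) _ _)
          (Continuous.intervalIntegrable (by fun_prop) _ _), intervalIntegral.integral_const_mul]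
      simp; ring
    rw [this]; linarith
  have hA2 : A ^ 2 ≤ (∫ t in a..b, ψ t) * ∫ t in a..b, f t ^ 2 := by
    have := sq_integral_mul_le hab cψ.sqrt cf
    have e1 : ∀ t, √(ψ t) * f t = forcingNorm R U t := fun t => by
      simp only [hf]; field_simp [hs0 t]
    have e2 : ∀ t, √(ψ t) ^ 2 = ψ t := fun t => Real.sq_sqrt (hψ0 t).le
    simpa only [e1, e2] using this
  have hf2 : 0 ≤ ∫ t in a..b, f t ^ 2 :=
    intervalIntegral.integral_nonneg hab fun _ _ => sq_nonneg _
  have h1 := H.integral_charBound_sq_le ha hb hab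
  have h2 := H.energy₂_le_integral_charBound ha hb hat htb
  have h3 : A ^ 2 ≤ 1 / 512 * ∫ t in a..b, f t ^ 2 := hA2.trans (by gcongr)
  rw [← hMdef, ← hA] at h1
  rw [← hMdef] at h2
  linarith

end RadialWave

namespace RadialWave

variable {t₀ t₁ R e : ℝ} {U : ℝ × ℝ → ℝ} (H : RadialWave t₀ t₁ R e U)
include H

theorem log_growth_le {ℓ : ℝ} (hℓ : 0 < ℓ) (h0 : energy₂ R U t₀ ≤ ℓ) (N : ℕ) :
    ∀ t ∈ Set.Icc t₀ t₁, 5 ^ N * ℓ ≤ energy₂ R U t →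
      Real.log (Real.log (2 + 8 * e + ℓ) + N + 1) - Real.log (Real.log (2 + 8 * e + ℓ) + 1) ≤
        2621440 * ∫ s in t₀..t, ∫ r in 0..R, density U (s, r) := by
  set B := Real.log (2 + 8 * e + ℓ) with hB
  have he := H.e_nonneg
  have hB0 : 0 ≤ B := Real.log_nonneg (by linarith)
  set δ : ℝ → ℝ := fun t => ∫ r in 0..R, density U (t, r) with hδ
  have cδ : Continuous δ :=
    continuous_intervalIntegral_snd (continuous_density H.smooth.continuous) _ _
  have hδ0 : ∀ t, 0 ≤ δ t := fun t => intervalIntegral.integral_nonneg H.R_pos.le fun r _ =>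
    density_nonneg U (t, r)
  have cy := continuous_energy₂ H.smooth R
  induction N with
  | zero =>
    intro t ht _
    have : 0 ≤ ∫ s in t₀..t, δ s := intervalIntegral.integral_nonneg ht.1 fun _ _ => hδ0 _
    simp only [Nat.cast_zero, add_zero, sub_self]
    positivity
  | succ N ih =>
    intro t ht hy
    have hlN : ℓ ≤ 5 ^ N * ℓ := le_mul_of_one_le_left hℓ.le (one_le_pow₀ (by norm_num))
    have hS : 5 ^ (N + 1) * ℓ = 5 * (5 ^ N * ℓ) := by ring
    have hcomp : IsCompact (Set.Icc t₀ t ∩ {s | 5 ^ (N + 1) * ℓ ≤ energy₂ R U s}) :=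
      isCompact_Icc.inter_right (isClosed_le continuous_const cy)
    obtain ⟨b, ⟨hb, hyb⟩, hbmin⟩ := hcomp.exists_isLeast ⟨t, ⟨ht.1, le_rfl⟩, hy⟩
    have hlt : ∀ s ∈ Set.Icc t₀ b, energy₂ R U s ≤ 5 ^ (N + 1) * ℓ := by
      intro s hs
      rcases hs.2.lt_or_eq with h | rfl
      · by_contra! hcon
        exact absurd (hbmin ⟨⟨hs.1, h.le.trans hb.2⟩, hcon.le⟩) (not_le.2 h)
      · obtain ⟨s', hs', he'⟩ := intermediate_value_Icc hb.1 cy.continuousOn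
          (show 5 ^ (N + 1) * ℓ ∈ Set.Icc (energy₂ R U t₀) (energy₂ R U s) from
            ⟨by linarith, hyb⟩)
        have : s' = s := le_antisymm hs'.2 (hbmin ⟨⟨hs'.1, hs'.2.trans hb.2⟩, he'.ge⟩)
        rw [← this, he']
    obtain ⟨a, ha, hya⟩ := intermediate_value_Icc hb.1 cy.continuousOn
      (show 5 ^ N * ℓ ∈ Set.Icc (energy₂ R U t₀) (energy₂ R U b) from
        ⟨by linarith, le_trans (by linarith) hyb⟩)
    have hbt := hb.2.trans ht.2
    have hih := ih a ⟨ha.1, ha.2.trans hbt⟩ hya.ge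
    have hΛ0 : 0 < B + N + 1 := by positivity
    have hstep : 1 / 1024 < 1280 * (2 * (B + N + 1)) * ∫ s in a..b, δ s := by
      by_contra! hcon
      have := H.energy₂_le_four_mul ha.1 hbt ha.2 (by positivity) (fun s hs r hr => ?_) hcon
        ha.2 le_rfl
      · have hyb' : 5 ^ (N + 1) * ℓ ≤ energy₂ R U b := hyb
        linarith
      · have hs' : s ∈ Set.Icc t₀ b := ⟨ha.1.trans hs.1, hs.2⟩
        have h1 := H.sq_le_energies ⟨hs'.1, hs.2.trans hbt⟩ hr.1 hr.2
        have h2 := hlt s hs'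
        have h5 : Real.log 5 ≤ 2 := by
          rw [Real.log_le_iff_le_exp (by norm_num)]
          have h6 : Real.exp 2 = Real.exp 1 * Real.exp 1 := by
            rw [← Real.exp_add]; norm_num
          nlinarith [Real.exp_one_gt_d9]
        have h3 : 2 + U (s, r) ^ 2 ≤ 5 ^ (N + 1) * (2 + 8 * e + ℓ) := by
          have : (1:ℝ) ≤ 5 ^ (N + 1) := one_le_pow₀ (by norm_num)
          nlinarith
        calc Real.log (2 + U (s, r) ^ 2) ≤ Real.log (5 ^ (N + 1) * (2 + 8 * e + ℓ)) :=
              Real.log_le_log (by positivity) h3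
          _ = (N + 1) * Real.log 5 + B := by
              rw [Real.log_mul (by positivity) (by positivity), Real.log_pow]
              push_cast; ring
          _ ≤ (N + 1) * 2 + B := by gcongr
          _ ≤ _ := by linarith
    have hsum : (∫ s in t₀..a, δ s) + (∫ s in a..b, δ s) ≤ ∫ s in t₀..t, δ s := by
      rw [intervalIntegral.integral_add_adjacent_intervals (cδ.intervalIntegrable _ _)
        (cδ.intervalIntegrable _ _)]
      exact intervalIntegral.integral_mono_interval le_rfl hb.1 hb.2
        (Filter.Eventually.of_forall hδ0) (cδ.intervalIntegrable _ _)
    have hlog : Real.log (B + (N + 1 : ℕ) + 1) - Real.log (B + N + 1) ≤ 1 / (B + N + 1) := by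
      rw [← Real.log_div (by positivity) hΛ0.ne']
      refine (Real.log_le_sub_one_of_pos (by positivity)).trans (le_of_eq ?_)
      field_simp
      push_cast; ring
    have hinv : 1 / (B + N + 1) ≤ 2621440 * ∫ s in a..b, δ s := by
      rw [div_le_iff₀ hΛ0]; linarith
    linarith

theorem energy₂_le_exp {ℓ t : ℝ} (hℓ : 0 < ℓ) (h0 : energy₂ R U t₀ ≤ ℓ)
    (ht : t ∈ Set.Icc t₀ t₁) :
    energy₂ R U t ≤ 5 * ℓ * Real.exp (2 * (Real.log (2 + 8 * e + ℓ) + 1) *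
      (Real.exp (15728640 * e ^ 2) - 1)) := by
  have he := H.e_nonneg
  have hB0 : 0 ≤ Real.log (2 + 8 * e + ℓ) := Real.log_nonneg (by linarith)
  have hK : 1 ≤ Real.exp (15728640 * e ^ 2) := Real.one_le_exp (by positivity)
  have hpos : 0 ≤ 2 * (Real.log (2 + 8 * e + ℓ) + 1) * (Real.exp (15728640 * e ^ 2) - 1) :=
    mul_nonneg (by positivity) (by linarith)
  rcases le_or_gt (energy₂ R U t) ℓ with hle | hgt
  · have := Real.one_le_exp hpos
    nlinarith
  obtain ⟨N, hN1, hN2⟩ := exists_nat_pow_near (x := energy₂ R U t / ℓ) (y := 5)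
    ((one_le_div hℓ).2 hgt.le) (by norm_num)
  rw [le_div_iff₀ hℓ] at hN1
  rw [div_lt_iff₀ hℓ] at hN2
  have h1 := H.log_growth_le hℓ h0 N t ht hN1
  have cδ : Continuous fun t => ∫ r in 0..R, density U (t, r) :=
    continuous_intervalIntegral_snd (continuous_density H.smooth.continuous) _ _
  have h2 : ∫ s in t₀..t, ∫ r in 0..R, density U (s, r) ≤ 6 * e ^ 2 :=
    (intervalIntegral.integral_mono_interval le_rfl ht.1 ht.2
      (Filter.Eventually.of_forall fun t => intervalIntegral.integral_nonneg H.R_pos.le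
        fun r _ => density_nonneg U (t, r)) (cδ.intervalIntegrable _ _)).trans H.integral_density_le
  set B := Real.log (2 + 8 * e + ℓ)
  have h3 : B + N + 1 ≤ Real.exp (15728640 * e ^ 2) * (B + 1) := by
    rw [← Real.log_le_log_iff (by positivity) (by positivity),
      Real.log_mul (by positivity) (by positivity), Real.log_exp]
    linarith
  have h5 : (5:ℝ) ≤ Real.exp 2 := by
    have h6 : Real.exp 2 = Real.exp 1 * Real.exp 1 := by
      rw [← Real.exp_add]; norm_num
    nlinarith [Real.exp_one_gt_d9]
  calc energy₂ R U t ≤ 5 * ℓ * 5 ^ N := by rw [pow_succ] at hN2; linarith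
    _ ≤ 5 * ℓ * Real.exp 2 ^ N := by gcongr
    _ = 5 * ℓ * Real.exp (N * 2) := by rw [Real.exp_nat_mul]
    _ ≤ _ := mul_le_mul_of_nonneg_left (Real.exp_le_exp.2 (by linarith)) (by positivity)

end RadialWave

/-! ### Finite speed of propagation and uniform compact support -/

theorem abs_le_of_deriv_le_exp {Z z : ℝ → ℝ} {s t c k : ℝ} (hst : s ≤ t) (hk : 0 < k)
    (hc : 0 ≤ c) (h0 : Z s = 0) (hZ : ∀ τ ∈ Set.Icc s t, HasDerivAt Z (z τ) τ)
    (hz : ∀ τ ∈ Set.Icc s t, |z τ| ≤ c * Real.exp (k * (τ - s))) :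
    |Z t| ≤ c / k * Real.exp (k * (t - s)) := by
  refine image_norm_le_of_norm_deriv_right_le_deriv_boundary (f := Z) (f' := z) (a := s) (b := t)
    (B := fun τ => c / k * Real.exp (k * (τ - s))) (B' := fun τ => c * Real.exp (k * (τ - s)))
    (fun τ hτ => (hZ τ hτ).continuousAt.continuousWithinAt)
    (fun τ hτ => (hZ τ ⟨hτ.1, hτ.2.le⟩).hasDerivWithinAt) ?_ (fun τ => ?_)
    (fun τ hτ => hz τ ⟨hτ.1, hτ.2.le⟩) ⟨hst, le_rfl⟩
  · rw [h0, norm_zero]; positivity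
  · have := ((((hasDerivAt_id τ).sub_const s).const_mul k).exp).const_mul (c / k)
    refine this.congr_deriv ?_
    simp; field_simp

/-- Solutions of a linear wave equation in one space dimension propagate at speed at most one. -/
theorem finite_speed {V a : ℝ × ℝ → ℝ} (hV : ContDiff ℝ (⊤ : ℕ∞) V) (ha : Continuous a)
    {s T N ρ : ℝ} (hsT : s ≤ T)
    (heq : ∀ t ∈ Set.Icc s T, ∀ r, dt (dt V) (t, r) = dr (dr V) (t, r) - a (t, r) * V (t, r))
    (h0 : ∀ r, N ≤ r → V (s, r) = 0) (h1 : ∀ r, N ≤ r → dt V (s, r) = 0)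
    (h2 : ∀ r, N ≤ r → dr V (s, r) = 0) (hρ : N + (T - s) ≤ ρ) : V (T, ρ) = 0 := by
  have cV := hV.continuous
  have hVt := contDiff_dt hV
  have hVr := contDiff_dr hV
  set X : ℝ × ℝ → ℝ := fun p => dt V p + dr V p with hX
  set Y : ℝ × ℝ → ℝ := fun p => dt V p - dr V p with hY
  have sX : ContDiff ℝ (⊤ : ℕ∞) X := hVt.add hVr
  have sY : ContDiff ℝ (⊤ : ℕ∞) Y := hVt.sub hVr
  have cX := sX.continuous
  have cY := sY.continuous
  set K : Set (ℝ × ℝ) := {p | p.1 ∈ Set.Icc s T ∧ |p.2 - ρ| ≤ T - p.1} with hK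
  have hKc : IsCompact K := by
    refine (isCompact_Icc.prod isCompact_Icc : IsCompact
      (Set.Icc s T ×ˢ Set.Icc (ρ - (T - s)) (ρ + (T - s)))).of_isClosed_subset ?_ ?_
    · exact (isClosed_Icc.preimage continuous_fst).inter
        (isClosed_le (f := fun p : ℝ × ℝ => |p.2 - ρ|) (g := fun p => T - p.1)
          (by fun_prop) (by fun_prop))
    · rintro ⟨t, r⟩ ⟨ht, hr⟩
      have := abs_le.1 hr
      have := ht.1
      exact ⟨ht, by simp only at *; linarith, by simp only at *; linarith⟩
  have hTK : (T, ρ) ∈ K := ⟨⟨hsT, le_rfl⟩, by simp⟩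
  obtain ⟨A, hA⟩ := hKc.exists_bound_of_continuousOn ha.continuousOn
  set k := 2 * (|A| + 1) with hk
  have hk0 : 0 < k := by positivity
  obtain ⟨p, hpK, hp⟩ := hKc.exists_isMaxOn ⟨_, hTK⟩
    (f := fun p => max (max |X p| |Y p|) |V p| * Real.exp (-(k * (p.1 - s)))) (by fun_prop)
  set m := max (max |X p| |Y p|) |V p| * Real.exp (-(k * (p.1 - s))) with hm
  have hm0 : 0 ≤ m := mul_nonneg ((abs_nonneg _).trans (le_max_right _ _)) (Real.exp_pos _).le
  have hmax : ∀ q ∈ K, max (max |X q| |Y q|) |V q| ≤ m * Real.exp (k * (q.1 - s)) := by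
    intro q hq
    have h : max (max |X q| |Y q|) |V q| * Real.exp (-(k * (q.1 - s))) ≤ m := hp hq
    rwa [Real.exp_neg, ← div_eq_mul_inv, div_le_iff₀ (Real.exp_pos _)] at h
  have hline : ∀ {t r : ℝ}, (t, r) ∈ K → ∀ (c : ℝ), |c| ≤ 1 → ∀ τ ∈ Set.Icc s t,
      (τ, r + c * (t - τ)) ∈ K := by
    rintro t r ⟨ht, hr⟩ c hc τ hτ
    refine ⟨⟨hτ.1, hτ.2.trans ht.2⟩, ?_⟩
    have h3 : |r + c * (t - τ) - ρ| ≤ |r - ρ| + |c * (t - τ)| := by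
      rw [show r + c * (t - τ) - ρ = (r - ρ) + c * (t - τ) by ring]
      exact abs_add_le _ _
    have h4 : |c * (t - τ)| ≤ t - τ := by
      rw [abs_mul, abs_of_nonneg (sub_nonneg.2 hτ.2)]
      exact mul_le_of_le_one_left (sub_nonneg.2 hτ.2) hc
    simp only at *
    linarith
  have hbase : ∀ {r : ℝ}, (s, r) ∈ K → N ≤ r := by
    rintro r ⟨-, hr⟩
    have := abs_le.1 hr
    simp only at this
    linarith
  have hX0 : ∀ {r : ℝ}, (s, r) ∈ K → X (s, r) = 0 := fun h => by
    simp [hX, h1 _ (hbase h), h2 _ (hbase h)]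
  have hY0 : ∀ {r : ℝ}, (s, r) ∈ K → Y (s, r) = 0 := fun h => by
    simp [hY, h1 _ (hbase h), h2 _ (hbase h)]
  have hV0 : ∀ {r : ℝ}, (s, r) ∈ K → V (s, r) = 0 := fun h => h0 _ (hbase h)
  have hXeq : ∀ t ∈ Set.Icc s T, ∀ r, dt X (t, r) - dr X (t, r) = -(a (t, r) * V (t, r)) := by
    intro t ht r
    rw [dt_eq_of_hasDerivAt sX ((hasDerivAt_dt hVt t r).add (hasDerivAt_dt hVr t r)),
      dr_eq_of_hasDerivAt sX ((hasDerivAt_dr hVt t r).add (hasDerivAt_dr hVr t r)),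
      dt_dr_comm hV, heq t ht r]
    ring
  have hYeq : ∀ t ∈ Set.Icc s T, ∀ r, dt Y (t, r) + dr Y (t, r) = -(a (t, r) * V (t, r)) := by
    intro t ht r
    rw [dt_eq_of_hasDerivAt sY ((hasDerivAt_dt hVt t r).sub (hasDerivAt_dt hVr t r)),
      dr_eq_of_hasDerivAt sY ((hasDerivAt_dr hVt t r).sub (hasDerivAt_dr hVr t r)),
      dt_dr_comm hV, heq t ht r]
    ring
  have hVb : ∀ q ∈ K, |-(a q * V q)| ≤ (k / 2 * m) * Real.exp (k * (q.1 - s)) := by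
    intro q hq
    rw [abs_neg, abs_mul, mul_assoc]
    have h3 : |a q| ≤ k / 2 := by
      have : |a q| ≤ A := hA q hq
      linarith [le_abs_self A]
    have h4 := (le_max_right _ _).trans (hmax q hq)
    gcongr
  have key : max (max |X p| |Y p|) |V p| ≤ (k / 2 * m) / k * Real.exp (k * (p.1 - s)) := by
    obtain ⟨t, r⟩ := p
    have htI := hpK.1
    have hkm : 0 ≤ k / 2 * m := by positivity
    have hmem : ∀ τ ∈ Set.Icc s t, τ ∈ Set.Icc s T := fun τ hτ => ⟨hτ.1, hτ.2.trans htI.2⟩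
    refine max_le (max_le ?_ ?_) ?_
    · have hl : ∀ τ ∈ Set.Icc s t, (τ, r + t - τ) ∈ K := fun τ hτ => by
        have := hline hpK 1 (by simp) τ hτ
        rwa [show r + 1 * (t - τ) = r + t - τ by ring] at this
      have := abs_le_of_deriv_le_exp (Z := fun τ => X (τ, r + t - τ)) htI.1 hk0 hkm
        (hX0 (hl s ⟨le_rfl, htI.1⟩))
        (fun τ hτ => (hasDerivAt_char sX (r + t) τ).congr_deriv (hXeq τ (hmem τ hτ) _))
        (fun τ hτ => hVb _ (hl τ hτ))
      simpa using this
    · have hl : ∀ τ ∈ Set.Icc s t, (τ, r - t + τ) ∈ K := fun τ hτ => by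
        have := hline hpK (-1) (by simp) τ hτ
        rwa [show r + -1 * (t - τ) = r - t + τ by ring] at this
      have := abs_le_of_deriv_le_exp (Z := fun τ => Y (τ, r - t + τ)) htI.1 hk0 hkm
        (hY0 (hl s ⟨le_rfl, htI.1⟩))
        (fun τ hτ => (hasDerivAt_char' sY (r - t) τ).congr_deriv (hYeq τ (hmem τ hτ) _))
        (fun τ hτ => hVb _ (hl τ hτ))
      simpa using this
    · have hl : ∀ τ ∈ Set.Icc s t, (τ, r) ∈ K := fun τ hτ => by
        simpa using hline hpK 0 (by simp) τ hτ
      refine abs_le_of_deriv_le_exp (Z := fun τ => V (τ, r)) htI.1 hk0 hkm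
        (hV0 (hl s ⟨le_rfl, htI.1⟩)) (fun τ _ => hasDerivAt_dt hV τ r) fun τ hτ => ?_
      have h3 := hmax _ (hl τ hτ)
      have h4 := (le_max_left _ _).trans ((le_max_left _ _).trans h3)
      have h5 := (le_max_right _ _).trans ((le_max_left _ _).trans h3)
      have h6 : dt V (τ, r) = (X (τ, r) + Y (τ, r)) / 2 := by simp only [hX, hY]; ring
      have h7 : |dt V (τ, r)| ≤ m * Real.exp (k * (τ - s)) := by
        rw [h6, abs_le]
        have := abs_le.1 h4
        have := abs_le.1 h5
        constructor <;> linarith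
      refine h7.trans ?_
      have : 1 ≤ k / 2 := by linarith [abs_nonneg A]
      have := le_mul_of_one_le_left hm0 this
      gcongr
  have hm' : m ≤ m / 2 := by
    have h3 : m ≤ (k / 2 * m) / k * Real.exp (k * (p.1 - s)) * Real.exp (-(k * (p.1 - s))) := by
      rw [hm]; gcongr
    rw [mul_assoc, ← Real.exp_add, add_neg_cancel, Real.exp_zero] at h3
    refine h3.trans (le_of_eq ?_)
    field_simp
  have hmz : m = 0 := by linarith
  have h3 := (le_max_right _ _).trans (hmax _ hTK)
  rw [hmz, zero_mul] at h3
  exact abs_nonpos_iff.1 h3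

/-- A finite-speed argument in both time directions, started from an interior time slab on which
the support is uniformly bounded, which exists by Baire's theorem. -/
theorem exists_vanishesOut {U : ℝ × ℝ → ℝ} {t₀ t₁ : ℝ} (hU : ContDiff ℝ (⊤ : ℕ∞) U)
    (hlt : t₀ < t₁) (heven : HasParity t₀ t₁ 1 U)
    (heqn : ∀ t ∈ Set.Icc t₀ t₁, ∀ r, r * dt (dt U) (t, r) =
      r * dr (dr U) (t, r) + 2 * dr U (t, r) - r * nonlin (U (t, r)))
    (hsupp : ∀ t ∈ Set.Icc t₀ t₁, ∃ n : ℕ, ∀ r : ℝ, n ≤ r → U (t, r) = 0) :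
    ∃ R > 0, VanishesOut t₀ t₁ R U := by
  have cU := hU.continuous
  set S : ℕ → Set ℝ := fun n => (Set.Ioo t₀ t₁)ᶜ ∪ {t | ∀ r : ℝ, n ≤ r → U (t, r) = 0} with hS
  have hScl : ∀ n, IsClosed (S n) := fun n => by
    refine isOpen_Ioo.isClosed_compl.union ?_
    simp only [Set.ofPred_forall]
    exact isClosed_iInter fun r => isClosed_iInter fun _ =>
      isClosed_eq (f := fun t => U (t, r)) (by fun_prop) continuous_const
  have hSun : ⋃ n, S n = Set.univ := by
    refine Set.eq_univ_of_forall fun t => Set.mem_iUnion.2 ?_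
    by_cases ht : t ∈ Set.Ioo t₀ t₁
    · obtain ⟨n, hn⟩ := hsupp t ⟨ht.1.le, ht.2.le⟩
      exact ⟨n, Or.inr hn⟩
    · exact ⟨0, Or.inl ht⟩
  obtain ⟨s, hs, hsS⟩ := (dense_iUnion_interior_of_closed hScl hSun).inter_open_nonempty _
    isOpen_Ioo (Set.nonempty_Ioo.2 hlt)
  obtain ⟨n, hn⟩ := Set.mem_iUnion.1 hsS
  have hev : ∀ᶠ t in nhds s, ∀ r : ℝ, n ≤ r → U (t, r) = 0 := by
    filter_upwards [mem_interior_iff_mem_nhds.1 hn, isOpen_Ioo.mem_nhds hs] with t h1 h2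
    exact h1.resolve_left fun h => h h2
  have hU0 := hev.self_of_nhds
  have hU1 : ∀ r : ℝ, n ≤ r → dt U (s, r) = 0 := fun r hr =>
    dt_eq_of_hasDerivAt hU ((hasDerivAt_const s 0).congr_of_eventuallyEq
      (hev.mono fun t ht => ht r hr))
  have hU2 : ∀ r : ℝ, n < r → dr U (s, r) = 0 := fun r hr =>
    dr_eq_of_hasDerivAt hU ((hasDerivAt_const r 0).congr_of_eventuallyEq
      ((lt_mem_nhds hr).mono fun t ht => hU0 t ht.le))
  set V := rmul U with hVdef
  have hV : ContDiff ℝ (⊤ : ℕ∞) V := contDiff_rmul hU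
  have hV0 : ∀ r : ℝ, (n + 1 : ℝ) ≤ r → V (s, r) = 0 := fun r hr => by
    simp [hVdef, rmul, hU0 r (by linarith)]
  have hV1 : ∀ r : ℝ, (n + 1 : ℝ) ≤ r → dt V (s, r) = 0 := fun r hr => by
    simp [hVdef, dt_rmul hU, rmul, hU1 r (by linarith)]
  have hV2 : ∀ r : ℝ, (n + 1 : ℝ) ≤ r → dr V (s, r) = 0 := fun r hr => by
    simp [hVdef, dr_rmul hU, rmul, hU0 r (by linarith), hU2 r (by linarith)]
  set a : ℝ × ℝ → ℝ := fun p => U p ^ 4 * Real.log (2 + U p ^ 2) with ha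
  have ca : Continuous a := (cU.pow 4).mul (continuous_log_two_add_sq.comp cU)
  have hVeq : ∀ t ∈ Set.Icc t₀ t₁, ∀ r,
      dt (dt V) (t, r) = dr (dr V) (t, r) - a (t, r) * V (t, r) := by
    intro t ht r
    rw [hVdef, dt_rmul hU, dt_rmul (contDiff_dt hU), dr_dr_rmul hU]
    have := heqn t ht r
    simp only [rmul, ha, nonlin] at *
    linarith
  have hvan : ∀ t ∈ Set.Icc t₀ t₁, ∀ r, n + 1 + (t₁ - t₀) ≤ r → V (t, r) = 0 := by
    intro t ht r hr
    rcases le_total s t with hst | hst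
    · exact finite_speed hV ca hst (fun τ hτ => hVeq τ ⟨hs.1.le.trans hτ.1, hτ.2.trans ht.2⟩)
        hV0 hV1 hV2 (by linarith [hs.1, ht.2])
    · set V' : ℝ × ℝ → ℝ := fun p => V (-p.1, p.2) with hV'
      have reflect : ∀ {W : ℝ × ℝ → ℝ}, ContDiff ℝ (⊤ : ℕ∞) W →
          ContDiff ℝ (⊤ : ℕ∞) fun p : ℝ × ℝ => W (-p.1, p.2) := fun h => by fun_prop
      have dt_reflect : ∀ {W : ℝ × ℝ → ℝ}, ContDiff ℝ (⊤ : ℕ∞) W →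
          dt (fun p => W (-p.1, p.2)) = fun p => -dt W (-p.1, p.2) := fun h => by
        ext ⟨t, r⟩
        refine dt_eq_of_hasDerivAt (reflect h) ?_
        simpa [Function.comp_def] using (hasDerivAt_dt h (-t) r).comp t (hasDerivAt_neg t)
      have dr_reflect : ∀ {W : ℝ × ℝ → ℝ}, ContDiff ℝ (⊤ : ℕ∞) W →
          dr (fun p => W (-p.1, p.2)) = fun p => dr W (-p.1, p.2) := fun h => by
        ext ⟨t, r⟩
        exact dr_eq_of_hasDerivAt (reflect h) (hasDerivAt_dr h (-t) r)
      have hdd : ∀ p, dt (dt V') p = dt (dt V) (-p.1, p.2) := by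
        rintro ⟨t, r⟩
        rw [hV', dt_reflect hV]
        refine dt_eq_of_hasDerivAt (reflect (contDiff_dt hV)).neg ?_
        have := ((hasDerivAt_dt (contDiff_dt hV) (-t) r).comp t (hasDerivAt_neg t)).neg
        exact this.congr_deriv (by simp)
      have := finite_speed (V := V') (a := fun p => a (-p.1, p.2)) (s := -s) (T := -t)
        (reflect hV) (by fun_prop) (neg_le_neg hst) (fun τ hτ r' => ?_)
        (fun r' hr' => by simpa [hV'] using hV0 r' hr')
        (fun r' hr' => by simpa [hV', dt_reflect hV] using hV1 r' hr')
        (fun r' hr' => by simpa [hV', dr_reflect hV] using hV2 r' hr')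
        (show (n + 1 : ℝ) + (-t - -s) ≤ r by linarith [hs.2, ht.1])
      · simpa [hV'] using this
      · rw [hdd, hV', dr_reflect hV, dr_reflect (contDiff_dr hV)]
        exact hVeq (-τ) ⟨by linarith [ht.1, hτ.2], by linarith [hs.2, hτ.1]⟩ r'
  refine ⟨n + 1 + (t₁ - t₀), by have := sub_pos.2 hlt; positivity, fun t ht r hr => ?_⟩
  have hpos : 0 < |r| := lt_of_le_of_lt (by have := sub_pos.2 hlt; positivity) hr
  have h3 : U (t, |r|) = 0 := by
    have := hvan t ht |r| hr.le
    exact (mul_eq_zero.1 this).resolve_left hpos.ne'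
  rcases abs_choice r with h | h
  · rwa [h] at h3
  · rw [h, heven t ht r] at h3
    simpa using h3

/-! ### Radial functions on `ℝ³` -/

theorem hasFDerivAt_norm_of_ne {x : Sp} (hx : x ≠ 0) :
    HasFDerivAt (fun y : Sp => ‖y‖) (‖x‖⁻¹ • innerSL ℝ x) x := by
  have hx' : ‖x‖ ≠ 0 := norm_ne_zero_iff.2 hx
  have h1 := (hasStrictFDerivAt_norm_sq x).hasFDerivAt.sqrt (pow_ne_zero 2 hx')
  simp only [Real.sqrt_sq (norm_nonneg _)] at h1
  refine h1.congr_fderiv ?_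
  ext v
  simp
  field_simp

theorem innerSL_single (x : Sp) (i : Fin 3) : innerSL ℝ x (EuclideanSpace.single i 1) = x i := by
  simp [EuclideanSpace.inner_single_right]

theorem pd_of_eventuallyEq_norm {v : Sp → ℝ} {φ : ℝ → ℝ} {x : Sp} {c : ℝ} (hx : x ≠ 0)
    (hv : v =ᶠ[nhds x] fun y => φ ‖y‖) (hφ : HasDerivAt φ c ‖x‖) (i : Fin 3) :
    pd i v x = c * (‖x‖⁻¹ * x i) := by
  have h1 := (hφ.comp_hasFDerivAt x (hasFDerivAt_norm_of_ne hx)).congr_of_eventuallyEq hv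
  rw [pd, h1.fderiv]
  simp only [smul_apply, smul_eq_mul, innerSL_single]

theorem pd_of_eventuallyEq_norm_mul {v : Sp → ℝ} {φ : ℝ → ℝ} {x : Sp} {c : ℝ} (hx : x ≠ 0)
    (j : Fin 3) (hv : v =ᶠ[nhds x] fun y => φ ‖y‖ * y j) (hφ : HasDerivAt φ c ‖x‖) (i : Fin 3) :
    pd i v x = c * (‖x‖⁻¹ * x i) * x j + φ ‖x‖ * (if i = j then 1 else 0) := by
  have h0 : HasFDerivAt (fun y : Sp => y j) (EuclideanSpace.proj j : Sp →L[ℝ] ℝ) x :=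
    (EuclideanSpace.proj j : Sp →L[ℝ] ℝ).hasFDerivAt
  have h1 := ((hφ.comp_hasFDerivAt x (hasFDerivAt_norm_of_ne hx)).mul h0).congr_of_eventuallyEq hv
  rw [pd, h1.fderiv]
  simp [innerSL_single, eq_comm]
  ring

theorem sum_sq_eq (x : Sp) : ∑ i, x i ^ 2 = ‖x‖ ^ 2 := by
  rw [EuclideanSpace.norm_sq_eq]; simp

theorem sum_pd_sq {v : Sp → ℝ} {φ : ℝ → ℝ} {x : Sp} {c : ℝ} (hx : x ≠ 0)
    (hv : v =ᶠ[nhds x] fun y => φ ‖y‖) (hφ : HasDerivAt φ c ‖x‖) :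
    ∑ i, pd i v x ^ 2 = c ^ 2 := by
  simp only [pd_of_eventuallyEq_norm hx hv hφ]
  have : ∀ i, (c * (‖x‖⁻¹ * x i)) ^ 2 = c ^ 2 * (‖x‖⁻¹) ^ 2 * x i ^ 2 := fun i => by ring
  simp only [this]
  rw [← Finset.mul_sum, sum_sq_eq]
  field_simp

theorem pd_pd {v : Sp → ℝ} {φ φ' : ℝ → ℝ} {x : Sp} {c : ℝ} (hx : x ≠ 0)
    (hv : ∀ y, v y = φ ‖y‖) (hφ : ∀ r, HasDerivAt φ (φ' r) r)
    (hφ' : HasDerivAt φ' c ‖x‖) (i j : Fin 3) :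
    pd i (pd j v) x = (c * ‖x‖⁻¹ - φ' ‖x‖ * ‖x‖⁻¹ ^ 2) * (‖x‖⁻¹ * x i) * x j +
      φ' ‖x‖ * ‖x‖⁻¹ * (if i = j then 1 else 0) := by
  have hx' : ‖x‖ ≠ 0 := norm_ne_zero_iff.2 hx
  have h1 : pd j v =ᶠ[nhds x] fun y => (φ' ‖y‖ * ‖y‖⁻¹) * y j := by
    filter_upwards [isOpen_ne.mem_nhds hx] with y hy
    rw [pd_of_eventuallyEq_norm hy (Filter.Eventually.of_forall hv) (hφ _)]
    ring
  refine pd_of_eventuallyEq_norm_mul (φ := fun r => φ' r * r⁻¹) hx j h1 ?_ i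
  refine (hφ'.mul (hasDerivAt_inv hx')).congr_deriv ?_
  ring

theorem lap_radial {v : Sp → ℝ} {φ φ' : ℝ → ℝ} {x : Sp} {c : ℝ} (hx : x ≠ 0)
    (hv : ∀ y, v y = φ ‖y‖) (hφ : ∀ r, HasDerivAt φ (φ' r) r)
    (hφ' : HasDerivAt φ' c ‖x‖) : lap v x = c + 2 * (φ' ‖x‖ * ‖x‖⁻¹) := by
  have h := sum_sq_eq x
  rw [Fin.sum_univ_three] at h
  simp only [lap, pd_pd hx hv hφ hφ', Fin.sum_univ_three, if_true]
  field_simp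
  linear_combination (c * ‖x‖ - φ' ‖x‖) * h

theorem sum_pd_pd_sq {v : Sp → ℝ} {φ φ' : ℝ → ℝ} {x : Sp} {c : ℝ} (hx : x ≠ 0)
    (hv : ∀ y, v y = φ ‖y‖) (hφ : ∀ r, HasDerivAt φ (φ' r) r)
    (hφ' : HasDerivAt φ' c ‖x‖) :
    ∑ i, ∑ j, pd i (pd j v) x ^ 2 = c ^ 2 + 2 * (φ' ‖x‖ * ‖x‖⁻¹) ^ 2 := by
  have h := sum_sq_eq x
  rw [Fin.sum_univ_three] at h
  simp only [pd_pd hx hv hφ hφ', Fin.sum_univ_three]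
  set β := φ' ‖x‖ * ‖x‖⁻¹ with hβ
  set α := (c * ‖x‖⁻¹ - φ' ‖x‖ * ‖x‖⁻¹ ^ 2) * ‖x‖⁻¹ with hα
  have hc : c = α * ‖x‖ ^ 2 + β := by rw [hα, hβ]; field_simp; ring
  have hαx : ∀ i j, (c * ‖x‖⁻¹ - φ' ‖x‖ * ‖x‖⁻¹ ^ 2) * (‖x‖⁻¹ * x i) * x j = α * x i * x j :=
    fun i j => by rw [hα]; ring
  simp only [hαx]
  rw [hc, ← h]
  simp
  ring

/-- The area of the unit sphere of `ℝ³`. -/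
def sphereArea : ℝ := 3 * (volume : Measure Sp).real (Metric.ball 0 1)

theorem sphereArea_pos : 0 < sphereArea :=
  mul_pos (by norm_num) (ENNReal.toReal_pos (Metric.measure_ball_pos _ _ one_pos).ne'
    measure_ball_lt_top.ne)

theorem integral_radial {g : ℝ → ℝ} {R : ℝ} (hR : 0 ≤ R) (hg : ∀ r, R < r → g r = 0) :
    ∫ x : Sp, g ‖x‖ = sphereArea * ∫ r in 0..R, r ^ 2 * g r := by
  rw [integral_fun_norm_addHaar (volume : Measure Sp) g, intervalIntegral.integral_of_le hR]
  have : ∫ r in Set.Ioi (0:ℝ), r ^ (Module.finrank ℝ Sp - 1) • g r =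
      ∫ r in Set.Ioc 0 R, r ^ 2 * g r := by
    simp only [finrank_euclideanSpace, Fintype.card_fin, smul_eq_mul]
    refine setIntegral_eq_of_subset_of_forall_sdiff_eq_zero measurableSet_Ioi
      Set.Ioc_subset_Ioi_self fun r hr => ?_
    have : R < r := by
      by_contra h
      exact hr.2 ⟨hr.1, not_lt.1 h⟩
    simp [hg r this]
  rw [this]
  simp [sphereArea]
  ring

theorem integral_eq_of_radial {w : Sp → ℝ} {g : ℝ → ℝ} {R : ℝ} (hR : 0 ≤ R)
    (hg : ∀ r, R < r → g r = 0) (hw : ∀ x, x ≠ 0 → w x = g ‖x‖) :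
    ∫ x, w x = sphereArea * ∫ r in 0..R, r ^ 2 * g r := by
  rw [← integral_radial hR hg]
  refine integral_congr_ae ?_
  have h0 : ∀ᵐ x : Sp, x ≠ 0 := by
    rw [ae_iff]
    simp
  filter_upwards [h0] with x hx using hw x hx

/-! ### Reduction of a spherically symmetric solution to its radial profile -/

/-- The profile of a spherically symmetric function, extended evenly to negative radii. -/
def profile (u : ℝ → Sp → ℝ) (p : ℝ × ℝ) : ℝ := u p.1 (p.2 • EuclideanSpace.single 0 1)

theorem contDiff_profile {u : ℝ → Sp → ℝ}
    (h : ContDiff ℝ (⊤ : ℕ∞) (fun p : ℝ × Sp => u p.1 p.2)) : ContDiff ℝ (⊤ : ℕ∞) (profile u) :=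
  h.comp (contDiff_fst.prodMk (contDiff_snd.smul contDiff_const))

theorem norm_smul_single (r : ℝ) : ‖r • (EuclideanSpace.single 0 1 : Sp)‖ = |r| := by
  simp [norm_smul]

section reduction

variable {t₀ t₁ : ℝ} {u : ℝ → Sp → ℝ} (hlt : t₀ < t₁)
  (hsol : IsClassicalSolution (Set.Icc t₀ t₁) u) (hrad : IsRadialSolution (Set.Icc t₀ t₁) u)

include hrad in
theorem eq_profile {t : ℝ} (ht : t ∈ Set.Icc t₀ t₁) (x : Sp) : u t x = profile u (t, ‖x‖) :=
  hrad t ht _ _ (by simp [norm_smul_single])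

include hrad in
theorem hasParity_profile : HasParity t₀ t₁ 1 (profile u) := fun t ht r => by
  rw [one_mul]
  exact hrad t ht _ _ (by simp [norm_smul_single])

include hsol in
theorem contDiff_time (x : Sp) : ContDiff ℝ (⊤ : ℕ∞) fun s => u s x :=
  hsol.1.comp (contDiff_id.prodMk contDiff_const)

include hlt hsol hrad

theorem deriv_time_eq {t : ℝ} (ht : t ∈ Set.Icc t₀ t₁) (x : Sp) :
    deriv (fun s => u s x) t = dt (profile u) (t, ‖x‖) :=
  hasDerivAt_unique_of_eqOn_Icc hlt ht (fun _ hs => eq_profile hrad hs x)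
    ((contDiff_time hsol x).differentiable (by simp) t).hasDerivAt
    (hasDerivAt_dt (contDiff_profile hsol.1) t ‖x‖)

theorem deriv_deriv_time_eq {t : ℝ} (ht : t ∈ Set.Icc t₀ t₁) (x : Sp) :
    deriv (deriv fun s => u s x) t = dt (dt (profile u)) (t, ‖x‖) := by
  have h1 : ContDiff ℝ 1 (deriv fun s => u s x) :=
    ((contDiff_time hsol x).of_le (by
      rw [one_add_one_eq_two]
      exact WithTop.coe_le_coe.2 (le_top : (2 : ℕ∞) ≤ ⊤)) : ContDiff ℝ (1 + 1) _).deriv'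
  exact hasDerivAt_unique_of_eqOn_Icc hlt ht (fun _ hs => deriv_time_eq hlt hsol hrad hs x)
    (h1.differentiable (by simp) t).hasDerivAt
    (hasDerivAt_dt (contDiff_dt (contDiff_profile hsol.1)) t ‖x‖)

theorem profile_equation {t : ℝ} (ht : t ∈ Set.Icc t₀ t₁) (r : ℝ) :
    r * dt (dt (profile u)) (t, r) = r * dr (dr (profile u)) (t, r) +
      2 * dr (profile u) (t, r) - r * nonlin (profile u (t, r)) := by
  have hU := contDiff_profile hsol.1
  have hp := hasParity_profile hrad
  have hpr := hp.radialDeriv hU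
  have hprr := hpr.radialDeriv (contDiff_dr hU)
  have hptt := (hp.timeDeriv hlt hU).timeDeriv hlt (contDiff_dt hU)
  have hpos : ∀ r > 0, r * dt (dt (profile u)) (t, r) = r * dr (dr (profile u)) (t, r) +
      2 * dr (profile u) (t, r) - r * nonlin (profile u (t, r)) := by
    intro r hr
    set x : Sp := r • EuclideanSpace.single 0 1 with hx
    have hn : ‖x‖ = r := by rw [hx, norm_smul_single, abs_of_pos hr]
    have hx0 : x ≠ 0 := norm_ne_zero_iff.1 (hn ▸ hr.ne')
    have h1 := hsol.2.2 t ht x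
    rw [deriv_deriv_time_eq hlt hsol hrad ht,
      lap_radial hx0 (eq_profile hrad ht) (fun r => hasDerivAt_dr hU t r)
        (hasDerivAt_dr (contDiff_dr hU) t ‖x‖), eq_profile hrad ht x, hn] at h1
    rw [h1]
    field_simp
  rcases lt_trichotomy r 0 with h | h | h
  · have h1 := hpos (-r) (neg_pos.2 h)
    rw [hp t ht, hpr t ht, hprr t ht, hptt t ht] at h1
    simp only [one_mul, neg_mul, neg_neg] at h1
    linarith
  · subst h
    have := hpr t ht 0
    simp at this
    simp; linarith
  · exact hpos r h

theorem exists_vanishesOut_profile : ∃ R > 0, VanishesOut t₀ t₁ R (profile u) := by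
  refine exists_vanishesOut (contDiff_profile hsol.1) hlt (hasParity_profile hrad)
    (fun t ht r => profile_equation hlt hsol hrad ht r) fun t ht => ?_
  obtain ⟨M, hM⟩ := (hsol.2.1 t ht).isCompact.isBounded.exists_norm_le
  obtain ⟨n, hn⟩ := exists_nat_gt (max M 0)
  refine ⟨n, fun r hr => ?_⟩
  by_contra hne
  have h1 := hM _ (subset_tsupport _ hne)
  rw [norm_smul_single, abs_of_nonneg ((le_max_right M 0).trans (hn.le.trans hr))] at h1
  linarith [le_max_left M 0]

variable {R : ℝ} (hR : 0 < R) (hv : VanishesOut t₀ t₁ R (profile u))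
include hR hv

theorem energy_eq_profile {t : ℝ} (ht : t ∈ Set.Icc t₀ t₁) :
    energy u t = sphereArea * ∫ r in 0..R, r ^ 2 * (1 / 2 * dt (profile u) (t, r) ^ 2 +
      1 / 2 * dr (profile u) (t, r) ^ 2 + Fpot (profile u (t, r))) := by
  have hU := contDiff_profile hsol.1
  refine integral_eq_of_radial (g := fun r => 1 / 2 * dt (profile u) (t, r) ^ 2 +
      1 / 2 * dr (profile u) (t, r) ^ 2 + Fpot (profile u (t, r))) hR.le (fun r hr => ?_)
      fun x hx => ?_
  · have hr' := hr.trans_le (le_abs_self r)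
    simp [hv t ht r hr', hv.timeDeriv hlt hU t ht r hr', hv.radialDeriv hU t ht r hr', Fpot_zero]
  · rw [deriv_time_eq hlt hsol hrad ht, sum_pd_sq hx
      (Filter.Eventually.of_forall (eq_profile hrad ht)) (hasDerivAt_dr hU t ‖x‖),
      eq_profile hrad ht x]

theorem radialWave_profile {E : ℝ} (hE : ∀ t ∈ Set.Icc t₀ t₁, energy u t = E) :
    RadialWave t₀ t₁ R (E / sphereArea) (profile u) where
  lt := hlt
  R_pos := hR
  smooth := contDiff_profile hsol.1
  even := hasParity_profile hrad
  supp := hv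
  eqn t ht r := profile_equation hlt hsol hrad ht r
  energy_le t ht := by
    rw [le_div_iff₀' sphereArea_pos, ← energy_eq_profile hlt hsol hrad hR hv ht, hE t ht]

theorem Dquant_sq_eq {E : ℝ} (hE : ∀ t ∈ Set.Icc t₀ t₁, energy u t = E) {t : ℝ}
    (ht : t ∈ Set.Icc t₀ t₁) :
    Dquant u t ^ 2 = sphereArea * ((∫ r in 0..R, r ^ 2 * dt (profile u) (t, r) ^ 2) +
      (∫ r in 0..R, r ^ 2 * dr (profile u) (t, r) ^ 2) + 1 / 2 * energy₂ R (profile u) t) := by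
  have hU := contDiff_profile hsol.1
  have H := radialWave_profile hlt hsol hrad hR hv hE
  set U := profile u with hUdef
  have hUt := contDiff_dt hU
  have hUr := contDiff_dr hU
  have c3 := (contDiff_dr hUt).continuous
  have c4 := (contDiff_dr hUr).continuous
  have hvt := hv.timeDeriv hlt hU
  have hvr := hv.radialDeriv hU
  rw [Dquant, Real.sq_sqrt (integral_nonneg fun x => by positivity)]
  rw [integral_eq_of_radial (R := R) (g := fun r => dt U (t, r) ^ 2 + dr U (t, r) ^ 2 +
      dr (dt U) (t, r) ^ 2 + (dr (dr U) (t, r) ^ 2 + 2 * (dr U (t, r) * r⁻¹) ^ 2)) hR.le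
      (fun r hr => ?_) fun x hx => ?_]
  · congr 1
    have e1 := integral_sq_deriv_r_mul (fun r => hasDerivAt_dr hUt t r) (by fun_prop)
      (H.dt_zero_at ht)
    have e2 := integral_sq_second_deriv_r_mul (fun r => hasDerivAt_dr hUr t r) (by fun_prop)
      (H.dr_zero_at ht)
    have e3 : ∀ r, dr (dt (rmul U)) (t, r) = dt U (t, r) + r * dr (dt U) (t, r) := fun r => by
      rw [dt_rmul hU, dr_rmul hUt]; rfl
    have e4 : ∀ r, dr (dr (rmul U)) (t, r) = 2 * dr U (t, r) + r * dr (dr U) (t, r) := fun r => by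
      rw [dr_dr_rmul hU]; rfl
    rw [H.energy₂_eq ht]
    simp only [e3, e4]
    rw [intervalIntegral.integral_add (Continuous.intervalIntegrable (by fun_prop) _ _)
      (Continuous.intervalIntegrable (by fun_prop) _ _), e1, e2, ← mul_assoc,
      show (1 / 2 * 2 : ℝ) = 1 by norm_num, one_mul,
      ← intervalIntegral.integral_add (Continuous.intervalIntegrable (by fun_prop) _ _)
      (Continuous.intervalIntegrable (by fun_prop) _ _),
      ← intervalIntegral.integral_add (Continuous.intervalIntegrable (by fun_prop) _ _)
      (Continuous.intervalIntegrable (by fun_prop) _ _),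
      ← intervalIntegral.integral_add (Continuous.intervalIntegrable (by fun_prop) _ _)
      (Continuous.intervalIntegrable (by fun_prop) _ _)]
    refine intervalIntegral.integral_congr fun r _ => ?_
    rcases eq_or_ne r 0 with rfl | hr
    · simp [H.dr_zero_origin ht]
    · field_simp
      ring
  · have hr' := hr.trans_le (le_abs_self r)
    simp [hvt t ht r hr', hvr t ht r hr', hvt.radialDeriv hUt t ht r hr',
      hvr.radialDeriv hUr t ht r hr']
  · have e1 : (fun y => deriv (fun s => u s y) t) = fun y => dt U (t, ‖y‖) :=
      funext fun y => deriv_time_eq hlt hsol hrad ht y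
    rw [deriv_time_eq hlt hsol hrad ht, e1, sum_pd_sq hx
      (Filter.Eventually.of_forall (eq_profile hrad ht)) (hasDerivAt_dr hU t ‖x‖),
      sum_pd_sq hx (Filter.Eventually.of_forall fun _ => rfl) (hasDerivAt_dr hUt t ‖x‖),
      sum_pd_pd_sq hx (eq_profile hrad ht) (fun r => hasDerivAt_dr hU t r)
        (hasDerivAt_dr hUr t ‖x‖)]

end reduction

/-! ### The uniform bound -/

theorem mul_exp_sub_one_le {c k E : ℝ} (hc : 0 ≤ c) (hk : 0 ≤ k) :
    c * (1 + E) * (Real.exp (k * E ^ 2) - 1) ≤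
      Real.exp ((2 * c * k + k + 1) * E ^ 2) - 1 := by
  have hx : 0 ≤ k * E ^ 2 := by positivity
  have h1 : Real.exp (k * E ^ 2) - 1 ≤ k * E ^ 2 * Real.exp (k * E ^ 2) := by
    have h := Real.add_one_le_exp (-(k * E ^ 2))
    have h' : Real.exp (-(k * E ^ 2)) * Real.exp (k * E ^ 2) = 1 := by
      rw [← Real.exp_add]; simp
    nlinarith [Real.exp_pos (k * E ^ 2)]
  have h1' : 0 ≤ Real.exp (k * E ^ 2) - 1 := by linarith [Real.one_le_exp hx]
  have h2 : 1 + E ≤ 2 * Real.exp (E ^ 2) := by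
    nlinarith [Real.add_one_le_exp (E ^ 2), sq_nonneg (E - 1)]
  set n := 2 * c * (k * E ^ 2) with hn
  set z := E ^ 2 + k * E ^ 2 with hz
  have hz0 : 0 ≤ z := by positivity
  calc c * (1 + E) * (Real.exp (k * E ^ 2) - 1)
      ≤ c * (2 * Real.exp (E ^ 2)) * (k * E ^ 2 * Real.exp (k * E ^ 2)) := by gcongr
    _ = n * Real.exp z := by rw [hz, Real.exp_add]; ring
    _ ≤ Real.exp n * Real.exp z - 1 := by
        nlinarith [Real.add_one_le_exp n, Real.one_le_exp hz0]
    _ = _ := by rw [← Real.exp_add]; congr 2; rw [hn, hz]; ring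

theorem growth_bound {κ : ℝ} (hκ : 0 < κ) {K : ℝ} (hK : 0 ≤ K) : ∃ C : ℝ, 1 ≤ C ∧
    ∀ E D : ℝ, 0 ≤ E → 0 ≤ D →
      2 * E + κ / 2 * (5 * (2 / κ * (2 + D) ^ 2) *
        Real.exp (2 * (Real.log (2 + 8 * (E / κ) + 2 / κ * (2 + D) ^ 2) + 1) *
          (Real.exp (K * (E / κ) ^ 2) - 1))) ≤
      (C * (2 + D) ^ ((2 + D) ^ (C * E ^ 2))) ^ 2 := by
  set k := K / κ ^ 2 with hk
  have hk0 : 0 ≤ k := by positivity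
  set c := 4 + 16 / κ with hc
  have hc0 : 0 ≤ c := by positivity
  set C₁ := 2 * c * k + k + 1 with hC₁
  have hC₁1 : 1 ≤ C₁ := le_add_of_nonneg_left (by positivity)
  refine ⟨2 * C₁ + 3, by linarith, fun E D hE hD => ?_⟩
  set L := Real.log (2 + D) with hL
  have hexpL : Real.exp L = 2 + D := Real.exp_log (by linarith)
  have hL2 : 1 / 2 ≤ L := by
    have := Real.log_le_log (by norm_num) (show (2:ℝ) ≤ 2 + D by linarith)
    linarith [Real.log_two_gt_d9]
  have hB : Real.log (2 + 8 * (E / κ) + 2 / κ * (2 + D) ^ 2) + 1 ≤ L * (c * (1 + E)) := by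
    have h1 : 2 + 8 * (E / κ) + 2 / κ * (2 + D) ^ 2 ≤
        Real.exp (2 * L) * Real.exp (2 / κ) * Real.exp (8 * (E / κ)) := by
      have e1 : Real.exp (2 * L) = (2 + D) ^ 2 := by
        rw [two_mul, Real.exp_add, hexpL]; ring
      have hD2 : 4 ≤ (2 + D) ^ 2 := by nlinarith
      have h2 := Real.add_one_le_exp (2 / κ)
      have h3 := Real.add_one_le_exp (8 * (E / κ))
      have hp : 0 ≤ 2 / κ := by positivity
      have hq : 0 ≤ 8 * (E / κ) := by positivity
      rw [e1]
      calc _ ≤ (2 + D) ^ 2 * (2 / κ + 1) * (8 * (E / κ) + 1) := by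
            nlinarith [mul_nonneg hp hq, mul_nonneg (mul_nonneg hp hq) (sq_nonneg (2 + D)),
              mul_le_mul_of_nonneg_right hD2 hq]
        _ ≤ _ := by gcongr
    rw [← Real.exp_add, ← Real.exp_add] at h1
    have h4 := Real.log_le_log (by positivity) h1
    rw [Real.log_exp] at h4
    have h5 : 1 ≤ 2 * L := by linarith
    have h6 : 2 / κ ≤ 2 * L * (2 / κ) := le_mul_of_one_le_left (by positivity) h5
    have h7 : 8 * (E / κ) ≤ 2 * L * (8 * (E / κ)) := le_mul_of_one_le_left (by positivity) h5
    have h8 : L * (c * (1 + E)) = 4 * L + 16 * (L / κ) + 4 * (L * E) + 16 * (L * E / κ) := by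
      rw [hc]; ring
    have h9 : 2 * L * (2 / κ) = 4 * (L / κ) := by ring
    have h10 : 2 * L * (8 * (E / κ)) = 16 * (L * E / κ) := by ring
    have h11 : 0 ≤ L * E := by positivity
    have h12 : 0 ≤ L / κ := by positivity
    linarith
  have hKk : K * (E / κ) ^ 2 = k * E ^ 2 := by rw [hk]; ring
  rw [hKk]
  have hexp1 : 0 ≤ Real.exp (k * E ^ 2) - 1 := by
    linarith [Real.one_le_exp (show 0 ≤ k * E ^ 2 by positivity)]
  have hexponent : 2 * (Real.log (2 + 8 * (E / κ) + 2 / κ * (2 + D) ^ 2) + 1) *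
      (Real.exp (k * E ^ 2) - 1) ≤ 2 * L * (Real.exp (C₁ * E ^ 2) - 1) := by
    calc _ ≤ 2 * (L * (c * (1 + E))) * (Real.exp (k * E ^ 2) - 1) := by gcongr
      _ = 2 * L * (c * (1 + E) * (Real.exp (k * E ^ 2) - 1)) := by ring
      _ ≤ _ := mul_le_mul_of_nonneg_left (mul_exp_sub_one_le hc0 hk0) (by linarith)
  set X := Real.exp (C₁ * E ^ 2) with hX
  have hmain : κ / 2 * (5 * (2 / κ * (2 + D) ^ 2) *
        Real.exp (2 * (Real.log (2 + 8 * (E / κ) + 2 / κ * (2 + D) ^ 2) + 1) *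
          (Real.exp (k * E ^ 2) - 1))) ≤ 5 * Real.exp (2 * L * X) := by
    calc _ = 5 * (2 + D) ^ 2 *
        Real.exp (2 * (Real.log (2 + 8 * (E / κ) + 2 / κ * (2 + D) ^ 2) + 1) *
          (Real.exp (k * E ^ 2) - 1)) := by field_simp
      _ ≤ 5 * (2 + D) ^ 2 * Real.exp (2 * L * (X - 1)) := by gcongr
      _ = 5 * Real.exp (2 * L * X) := by
          rw [← hexpL, ← Real.exp_nat_mul, mul_assoc, ← Real.exp_add]
          congr 2; push_cast; ring
  have hE2 : 2 * E ≤ Real.exp (2 * L * X) := by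
    have h1 : E ^ 2 ≤ C₁ * E ^ 2 := le_mul_of_one_le_left (sq_nonneg E) hC₁1
    have h2 := Real.add_one_le_exp (C₁ * E ^ 2)
    have h3 : X ≤ 2 * L * X := le_mul_of_one_le_left (Real.exp_pos _).le (by linarith)
    have h4 := Real.add_one_le_exp (2 * L * X)
    nlinarith [sq_nonneg (E - 1)]
  have hpow : Real.exp (L * X) ≤ (2 + D) ^ ((2 + D) ^ ((2 * C₁ + 3) * E ^ 2)) := by
    rw [Real.rpow_def_of_pos (show 0 < 2 + D by linarith),
      Real.rpow_def_of_pos (show 0 < 2 + D by linarith), ← hL]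
    refine Real.exp_le_exp.2 (mul_le_mul_of_nonneg_left (Real.exp_le_exp.2 ?_) (by linarith))
    rw [← mul_assoc]
    refine mul_le_mul_of_nonneg_right ?_ (sq_nonneg E)
    nlinarith
  calc _ ≤ 6 * Real.exp (2 * L * X) := by linarith
    _ = 6 * Real.exp (L * X) ^ 2 := by
        rw [← Real.exp_nat_mul]; congr 2; push_cast; ring
    _ ≤ (2 * C₁ + 3) ^ 2 * Real.exp (L * X) ^ 2 := by
        gcongr
        nlinarith
    _ = ((2 * C₁ + 3) * Real.exp (L * X)) ^ 2 := by ring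
    _ ≤ _ := by gcongr

theorem Dquant_nonneg (u : ℝ → Sp → ℝ) (t : ℝ) : 0 ≤ Dquant u t := Real.sqrt_nonneg _

theorem le_mul_rpow_rpow {C D E : ℝ} (hC : 1 ≤ C) (hD : 0 ≤ D) :
    D ≤ C * (2 + D) ^ ((2 + D) ^ (C * E ^ 2)) := by
  have h1 : (1:ℝ) ≤ (2 + D) ^ (C * E ^ 2) :=
    Real.one_le_rpow (by linarith) (by positivity)
  have h2 : 2 + D ≤ (2 + D) ^ ((2 + D) ^ (C * E ^ 2)) :=
    Real.self_le_rpow_of_one_le (by linarith) h1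
  nlinarith

/-- **Uniform `H²×H¹`-type bound.** For a spherically symmetric classical solution on a
compact time interval with conserved energy `E` and `D = ‖∇_{t,x}u(t₀)‖_{H¹}`, one has
`‖∇_{t,x}u(t)‖_{H¹} ≤ C (2+D)^{(2+D)^{C E²}}` for all `t` in the interval, with an
absolute constant `C`; in particular the bound is independent of the interval length. -/
theorem uniform_H2_bound :
    ∃ C > (0:ℝ), ∀ (t₀ t₁ : ℝ), t₀ ≤ t₁ → ∀ (u : ℝ → Sp → ℝ) (E : ℝ),
      IsClassicalSolution (Set.Icc t₀ t₁) u →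
      IsRadialSolution (Set.Icc t₀ t₁) u →
      (∀ t ∈ Set.Icc t₀ t₁, energy u t = E) →
      ∀ t ∈ Set.Icc t₀ t₁,
        Dquant u t ≤ C * (2 + Dquant u t₀) ^
          ((2 + Dquant u t₀) ^ (C * E ^ 2)) := by
  obtain ⟨C, hC1, hC⟩ := growth_bound sphereArea_pos (show (0:ℝ) ≤ 15728640 by norm_num)
  refine ⟨C, by linarith, fun t₀ t₁ hle u E hsol hrad hE t ht => ?_⟩
  rcases hle.eq_or_lt with rfl | hlt
  · obtain rfl : t = t₀ := le_antisymm ht.2 ht.1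
    exact le_mul_rpow_rpow hC1 (Dquant_nonneg u t)
  obtain ⟨R, hR, hv⟩ := exists_vanishesOut_profile hlt hsol hrad
  have H := radialWave_profile hlt hsol hrad hR hv hE
  have hκ := sphereArea_pos
  have ht₀ : t₀ ∈ Set.Icc t₀ t₁ := ⟨le_rfl, hlt.le⟩
  have hE0 : 0 ≤ E := by
    have := mul_nonneg H.e_nonneg hκ.le
    rwa [div_mul_cancel₀ _ hκ.ne'] at this
  have hD0 := Dquant_nonneg u t₀
  have hstart : energy₂ R (profile u) t₀ ≤ 2 / sphereArea * (2 + Dquant u t₀) ^ 2 := by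
    have h1 := Dquant_sq_eq hlt hsol hrad hR hv hE ht₀
    have h2 : 0 ≤ ∫ r in 0..R, r ^ 2 * dt (profile u) (t₀, r) ^ 2 :=
      intervalIntegral.integral_nonneg hR.le fun r _ => by positivity
    have h3 : 0 ≤ ∫ r in 0..R, r ^ 2 * dr (profile u) (t₀, r) ^ 2 :=
      intervalIntegral.integral_nonneg hR.le fun r _ => by positivity
    rw [div_mul_eq_mul_div, le_div_iff₀ hκ]
    nlinarith
  have hgrow := H.energy₂_le_exp (by positivity) hstart ht
  have hend : Dquant u t ^ 2 ≤ 2 * E + sphereArea / 2 * energy₂ R (profile u) t := by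
    have h1 := mul_le_mul_of_nonneg_left (H.integral_kinetic_le ht) hκ.le
    have h2 : sphereArea * (2 * (E / sphereArea)) = 2 * E := by field_simp
    rw [Dquant_sq_eq hlt hsol hrad hR hv hE ht]
    linarith
  refine le_of_sq_le_sq ?_ (by positivity)
  refine hend.trans (le_trans ?_ (hC E _ hE0 hD0))
  gcongr
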